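/- arXiv:2008.09415 — 13 statements merged into one kernel-verified Lean document; each statement's English description precedes it below -/
import Mathlib

section
/- Let F be a finite simple graph, let k ≥ 2 be an integer, and let S be the full 1-subdivision of F, i.e., the graph obtained from F by subdividing every edge exactly once. If S admits an acyclic k-colouring, then F admits a proper colouring with at most 2k(k−1) colours. -/
open Classical in
/-- A greedy colouring of a graph in which every nonempty set of vertices contains a vertex with
fewer than `d` neighbours in that set. -/
theorem SimpleGraph.colorable_of_forall_exists_card_lt {V : Type*} [Fintype V]
    (G : SimpleGraph V) (d : ℕ)
    (h : ∀ s : Finset V, s.Nonempty → ∃ v ∈ s, (s.filter (G.Adj v)).card < d) :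
    G.Colorable d := by
  suffices H : ∀ s : Finset V, ∃ f : s → Fin d, ∀ u v : s, G.Adj u v → f u ≠ f v by
    obtain ⟨f, hf⟩ := H Finset.univ
    exact ⟨Coloring.mk (fun v => f ⟨v, Finset.mem_univ v⟩) fun {u v} huv => hf _ _ huv⟩
  intro s
  induction s using Finset.strongInduction with
  | H s ih =>
    rcases s.eq_empty_or_nonempty with rfl | hs
    · exact ⟨fun v => (Finset.notMem_empty _ v.2).elim,
        fun v => (Finset.notMem_empty _ v.2).elim⟩
    obtain ⟨v, hv, hcard⟩ := h s hs
    obtain ⟨f, hf⟩ := ih (s.erase v) (Finset.erase_ssubset hv)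
    have : NeZero d := ⟨by omega⟩
    let g : V → Fin d := fun w => if hw : w ∈ s.erase v then f ⟨w, hw⟩ else 0
    obtain ⟨a, -, ha⟩ : ∃ a ∈ Finset.univ, a ∉ (s.filter (G.Adj v)).image g :=
      Finset.exists_mem_notMem_of_card_lt_card
        (Finset.card_image_le.trans_lt (by simpa using hcard))
    have hg : ∀ w ∈ s, G.Adj v w → g w ≠ a := fun w hw hvw hwa =>
      ha (Finset.mem_image.2 ⟨w, by simp [hw, hvw], hwa⟩)
    refine ⟨fun w => if (w : V) = v then a else g w, ?_⟩
    rintro ⟨x, hx⟩ ⟨y, hy⟩ (hxy : G.Adj x y)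
    by_cases hxv : x = v
    · subst hxv
      simpa [hxy.ne'] using (hg y hy hxy).symm
    · by_cases hyv : y = v
      · subst hyv
        simpa [hxv] using hg x hx hxy.symm
      · simpa [hxv, hyv, g, hx, hy] using
          hf ⟨x, Finset.mem_erase.2 ⟨hxv, hx⟩⟩ ⟨y, Finset.mem_erase.2 ⟨hyv, hy⟩⟩ hxy

/-- A forest on a nonempty finite vertex set has fewer edges than vertices. -/
theorem SimpleGraph.IsAcyclic.card_edgeFinset_lt {V : Type*} [Fintype V] [Nonempty V]
    {G : SimpleGraph V} [Fintype G.edgeSet] (hG : G.IsAcyclic) :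
    G.edgeFinset.card < Fintype.card V := by
  classical
  obtain ⟨T, hGT, -, hT⟩ := connected_top.exists_isTree_le_of_le_of_isAcyclic le_top hG
  have h₁ := hT.card_edgeFinset
  have h₂ := Finset.card_le_card (edgeFinset_mono hGT)
  omega

open Classical in
theorem SimpleGraph.IsAcyclic.sum_card_filter_adj_lt {V : Type*} {G : SimpleGraph V}
    (hG : G.IsAcyclic) {s : Finset V} (hs : s.Nonempty) :
    ∑ v ∈ s, (s.filter (G.Adj v)).card < 2 * s.card := by
  have : Nonempty s := hs.to_subtype
  let H : SimpleGraph s := G.comap Subtype.val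
  have hH : H.IsAcyclic := hG.comap ⟨Subtype.val, id⟩ Subtype.val_injective
  have hlt := hH.card_edgeFinset_lt
  rw [Fintype.card_coe] at hlt
  have hdeg : ∀ v : s, (s.filter (G.Adj v)).card = H.degree v := fun v => by
    rw [← card_neighborFinset_eq_degree, ← Finset.card_map (Function.Embedding.subtype _)]
    congr 1
    ext w
    simp [H, and_comm]
  rw [← Finset.sum_coe_sort]
  simp_rw [hdeg]
  rw [H.sum_degrees_eq_twice_card_edges]
  omega

/-- A graph whose edges are covered by `m ≥ 1` forests is `2m`-colourable. -/
theorem SimpleGraph.colorable_of_le_iSup_isAcyclic {V ι : Type*} [Fintype V] [Fintype ι]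
    [Nonempty ι] (G : SimpleGraph V) (T : ι → SimpleGraph V) (hT : ∀ i, (T i).IsAcyclic)
    (hG : G ≤ ⨆ i, T i) : G.Colorable (2 * Fintype.card ι) := by
  classical
  refine G.colorable_of_forall_exists_card_lt _ fun s hs => ?_
  refine Finset.exists_lt_of_sum_lt ?_
  calc ∑ v ∈ s, (s.filter (G.Adj v)).card
      ≤ ∑ v ∈ s, ∑ i, (s.filter ((T i).Adj v)).card := by
        refine Finset.sum_le_sum fun v _ => ?_
        refine (Finset.card_le_card fun w hw => ?_).trans Finset.card_biUnion_le
        rw [Finset.mem_filter] at hw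
        obtain ⟨i, hi⟩ := iSup_adj.1 (hG hw.2)
        exact Finset.mem_biUnion.2 ⟨i, Finset.mem_univ i, Finset.mem_filter.2 ⟨hw.1, hi⟩⟩
    _ = ∑ i, ∑ v ∈ s, (s.filter ((T i).Adj v)).card := Finset.sum_comm
    _ < ∑ _i : ι, 2 * s.card :=
        Finset.sum_lt_sum_of_nonempty Finset.univ_nonempty
          fun i _ => (hT i).sum_card_filter_adj_lt hs
    _ = ∑ _v ∈ s, 2 * Fintype.card ι := by simp; ring

/-- The graph of those edges of `F` whose ends have colour `i` and whose subdivision vertex has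
colour `j`. -/
def SimpleGraph.subdivisionPart {V α : Type*} (F : SimpleGraph V) (c : V ⊕ ↥F.edgeSet → α)
    (i j : α) : SimpleGraph V where
  Adj u v := c (.inl u) = i ∧ c (.inl v) = i ∧ ∃ e : F.edgeSet, e.1 = s(u, v) ∧ c (.inr e) = j
  symm := ⟨fun u v ⟨hu, hv, e, he, hc⟩ => ⟨hv, hu, e, he.trans Sym2.eq_swap, hc⟩⟩
  loopless := ⟨fun u ⟨_, _, e, he, _⟩ => F.loopless.irrefl u (by
    have := e.2; rwa [he] at this)⟩

theorem SimpleGraph.isAcyclic_subdivisionPart {V α : Type*} {F : SimpleGraph V}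
    {S : SimpleGraph (V ⊕ ↥F.edgeSet)}
    (hS : ∀ (x : V) (e : ↥F.edgeSet), x ∈ (e : Sym2 V) → S.Adj (.inl x) (.inr e))
    {c : V ⊕ ↥F.edgeSet → α} {i j : α}
    (h : (S.induce {w | c w = i ∨ c w = j}).IsAcyclic) :
    (F.subdivisionPart c i j).IsAcyclic := by
  rw [isAcyclic_iff_forall_adj_isBridge] at h ⊢
  intro v w hvw
  obtain ⟨hv, hw, e, he, hc⟩ := id hvw
  rw [isBridge_iff]
  intro hreach
  let v' : {x | c x = i ∨ c x = j} := ⟨.inl v, .inl hv⟩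
  let w' : {x | c x = i ∨ c x = j} := ⟨.inl w, .inl hw⟩
  let e' : {x | c x = i ∨ c x = j} := ⟨.inr e, .inr hc⟩
  have hadj : ∀ (x : V) (hx : c (.inl x) = i) (f : F.edgeSet) (hf : c (.inr f) = j), x ∈ f.1 →
      (x ≠ v ∨ f ≠ e) → ((S.induce {x | c x = i ∨ c x = j}).deleteEdges {s(v', e')}).Adj
        ⟨.inl x, .inl hx⟩ ⟨.inr f, .inr hf⟩ := by
    intro x hx f hf hxf hne
    rw [deleteEdges_adj]
    refine ⟨hS x f hxf, ?_⟩
    simp only [Set.mem_singleton_iff, Sym2.eq_iff, v', e', Subtype.mk.injEq, Sum.inl.injEq,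
      Sum.inr.injEq, reduceCtorEq, and_self, or_false]
    tauto
  have hbridge := h (v := v') (w := e') (hS v e (by simp [he]))
  rw [isBridge_iff] at hbridge
  refine hbridge (Reachable.trans (v := w') ?_
    (hadj w hw e hc (by simp [he]) (.inl fun hwv => hvw.ne hwv.symm)).reachable)
  have hlift : ∀ x y, ((F.subdivisionPart c i j).deleteEdges {s(v, w)}).Walk x y →
      ∀ (hx : c (.inl x) = i) (hy : c (.inl y) = i),
      ((S.induce {x | c x = i ∨ c x = j}).deleteEdges {s(v', e')}).Reachable
        ⟨.inl x, .inl hx⟩ ⟨.inl y, .inl hy⟩ := by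
    intro x y p
    induction p with
    | nil => exact fun _ _ => .rfl
    | cons hxy p ih =>
      intro hx hy
      rw [deleteEdges_adj] at hxy
      obtain ⟨⟨-, hz, f, hf, hcf⟩, hne⟩ := hxy
      have hfe : f ≠ e := by
        rintro rfl
        exact hne (hf.symm.trans he)
      exact ((hadj _ hx f hcf (by simp [hf]) (.inr hfe)).reachable.trans
        (hadj _ hz f hcf (by simp [hf]) (.inr hfe)).symm.reachable).trans (ih hz hy)
  obtain ⟨p⟩ := hreach
  exact hlift v w p hv hw


/-- If the full 1-subdivision `S` of a finite simple graph `F`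
(obtained by subdividing every edge of `F` exactly once) admits an acyclic
`k`-colouring (k ≥ 2), then `F` admits a proper colouring with at most
`2k(k-1)` colours. -/
theorem stmt_5 {V : Type*} [Fintype V] (F : SimpleGraph V) (k : ℕ) (hk : 2 ≤ k)
    (S : SimpleGraph (V ⊕ ↥F.edgeSet))
    (hS : ∀ a b : V ⊕ ↥F.edgeSet, S.Adj a b ↔
      ∃ (x : V) (e : ↥F.edgeSet), x ∈ (e : Sym2 V) ∧
        ((a = Sum.inl x ∧ b = Sum.inr e) ∨ (a = Sum.inr e ∧ b = Sum.inl x)))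
    (c : V ⊕ ↥F.edgeSet → Fin k)
    (hproper : ∀ u v, S.Adj u v → c u ≠ c v)
    (hacyc : ∀ i j : Fin k, i ≠ j → (S.induce {w | c w = i ∨ c w = j}).IsAcyclic) :
    F.Colorable (2 * k * (k - 1)) := by
  have hadj : ∀ (x : V) (e : ↥F.edgeSet), x ∈ (e : Sym2 V) → S.Adj (.inl x) (.inr e) :=
    fun x e hx => (hS _ _).2 ⟨x, e, hx, .inl ⟨rfl, rfl⟩⟩
  have hcol : ∀ i : Fin k,
      (⨆ j : {j // j ≠ i}, F.subdivisionPart c i j).Colorable (2 * (k - 1)) := by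
    intro i
    have : Nontrivial (Fin k) := Fin.nontrivial_iff_two_le.2 hk
    have : Nonempty {j // j ≠ i} := (exists_ne i).elim fun j hj => ⟨⟨j, hj⟩⟩
    have hcard : Fintype.card {j // j ≠ i} = k - 1 := by simp
    rw [← hcard]
    exact SimpleGraph.colorable_of_le_iSup_isAcyclic _ _
      (fun j => SimpleGraph.isAcyclic_subdivisionPart hadj (hacyc i j j.2.symm)) le_rfl
  let C : ∀ i : Fin k, (⨆ j : {j // j ≠ i}, F.subdivisionPart c i j).Coloring
    (Fin (2 * (k - 1))) := fun i => (hcol i).some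
  let D : F.Coloring (Fin k × Fin (2 * (k - 1))) :=
    SimpleGraph.Coloring.mk (fun v => (c (.inl v), C (c (.inl v)) v)) fun {u v} huv heq => by
      obtain ⟨h₁, h₂⟩ := Prod.mk.inj heq
      let e : F.edgeSet := ⟨s(u, v), huv⟩
      rw [← h₁] at h₂
      refine (C (c (.inl u))).valid (SimpleGraph.iSup_adj.2
        ⟨⟨c (.inr e), (hproper _ _ (hadj u e (by simp [e]))).symm⟩, ?_⟩) h₂
      exact ⟨rfl, h₁.symm, e, rfl, rfl⟩
  convert D.colorable using 1
  simp
  ring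
end

section
/- Let G be a finite bipartite graph with parts A and B where |A| = |B| = n. Then G has a connected matching of size n if and only if the complement of G has an acyclic colouring using n colours. -/
namespace SimpleGraph

variable {V : Type*}

/-- A graph is acyclic if every nonempty set of vertices contains a vertex with at most one
neighbour in the set. -/
theorem isAcyclic_of_forall_exists_subsingleton (H : SimpleGraph V)
    (h : ∀ S : Set V, S.Nonempty → ∃ v ∈ S, ∀ x ∈ S, ∀ y ∈ S, H.Adj v x → H.Adj v y → x = y) :
    H.IsAcyclic := by
  intro u p hp
  obtain ⟨v, hv, hsub⟩ := h {x | x ∈ p.support} ⟨u, p.start_mem_support⟩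
  have h2 := hp.ncard_neighborSet_toSubgraph_eq_two hv
  obtain ⟨x, y, hxy, hN⟩ := Set.ncard_eq_two.mp h2
  have hx : p.toSubgraph.Adj v x := by
    rw [← Subgraph.mem_neighborSet, hN]; simp
  have hy : p.toSubgraph.Adj v y := by
    rw [← Subgraph.mem_neighborSet, hN]; simp
  exact hxy (hsub x (p.mem_verts_toSubgraph.mp hx.snd_mem) y
    (p.mem_verts_toSubgraph.mp hy.snd_mem) hx.adj_sub hy.adj_sub)

/-- An induced subgraph on `{x, x', y, y'}` whose only possible edges are those of the path
`y, x', y', x` is acyclic. -/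
theorem isAcyclic_induce_of_four (H : SimpleGraph V) {x x' y y' : V} (T : Set V)
    (hT : ∀ v ∈ T, v = x ∨ v = x' ∨ v = y ∨ v = y')
    (hx : ¬H.Adj x x') (hy : ¬H.Adj y y') (hxy : ¬H.Adj x y) : (H.induce T).IsAcyclic := by
  apply isAcyclic_of_forall_exists_subsingleton
  have key : ∀ {v a : V}, (∀ w ∈ T, H.Adj v w → w = a) → ∀ p q r : T, (p : V) = v →
      (H.induce T).Adj p q → (H.induce T).Adj p r → q = r := by
    intro v a hva p q r hp hq hr
    subst hp
    exact Subtype.ext ((hva q q.2 hq).trans (hva r r.2 hr).symm)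
  rintro S ⟨s, hs⟩
  by_cases h1 : ∃ p ∈ S, (p : V) = x
  · obtain ⟨p, hp, hpx⟩ := h1
    refine ⟨p, hp, fun q _ r _ => key (v := x) (a := y') ?_ p q r hpx⟩
    intro w hw hadj
    rcases hT w hw with rfl | rfl | rfl | rfl
    · exact absurd hadj (H.irrefl)
    · exact absurd hadj hx
    · exact absurd hadj hxy
    · rfl
  by_cases h2 : ∃ p ∈ S, (p : V) = y
  · obtain ⟨p, hp, hpy⟩ := h2
    refine ⟨p, hp, fun q _ r _ => key (v := y) (a := x') ?_ p q r hpy⟩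
    intro w hw hadj
    rcases hT w hw with rfl | rfl | rfl | rfl
    · exact absurd hadj.symm hxy
    · rfl
    · exact absurd hadj (H.irrefl)
    · exact absurd hadj hy
  push Not at h1 h2
  have hS : ∀ p ∈ S, (p : V) = x' ∨ (p : V) = y' := by
    intro p hp
    have := hT p p.2
    have := h1 p hp
    have := h2 p hp
    tauto
  refine ⟨s, hs, fun q hq r hr hsq hsr => Subtype.ext ?_⟩
  have hq' : (s : V) ≠ q := H.ne_of_adj hsq
  have hr' : (s : V) ≠ r := H.ne_of_adj hsr
  grind

/-- An acyclic graph contains no cycle of length four. -/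
theorem IsAcyclic.not_four_cycle {H : SimpleGraph V} (hH : H.IsAcyclic) {a b c d : V}
    (hab : H.Adj a b) (hbc : H.Adj b c) (hcd : H.Adj c d) (hda : H.Adj d a)
    (hac : a ≠ c) (hbd : b ≠ d) : False := by
  refine hH (Walk.cons hab (Walk.cons hbc (Walk.cons hcd (Walk.cons hda Walk.nil)))) ?_
  have := hab.ne
  have := hbc.ne
  have := hcd.ne
  have := hda.ne
  rw [Walk.cons_isCycle_iff]
  simp [Walk.isPath_def]
  grind

/-- A matching with half as many edges as there are vertices covers every vertex. -/
theorem exists_mem_of_matching_card [Fintype V] [DecidableEq V] (G : SimpleGraph V)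
    (M : Finset (Sym2 V)) (hM : ∀ e ∈ M, e ∈ G.edgeSet)
    (hdis : ∀ e ∈ M, ∀ f ∈ M, e ≠ f → ∀ v : V, ¬(v ∈ e ∧ v ∈ f))
    (hcard : Fintype.card V = 2 * M.card) (v : V) : ∃ e ∈ M, v ∈ e := by
  have hU : M.biUnion Sym2.toFinset = Finset.univ := by
    rw [← Finset.card_eq_iff_eq_univ, hcard, Finset.card_biUnion]
    · rw [Finset.sum_congr rfl (fun e he => Sym2.card_toFinset_of_not_isDiag e
        (G.not_isDiag_of_mem_edgeSet (hM e he)))]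
      simp [mul_comm]
    · intro e he f hf hef
      rw [Function.onFun, Finset.disjoint_left]
      intro w hwe hwf
      exact hdis e he f hf hef w ⟨Sym2.mem_toFinset.mp hwe, Sym2.mem_toFinset.mp hwf⟩
  simpa using hU.ge (Finset.mem_univ v)

end SimpleGraph


/-- A finite bipartite graph `G` with parts `A`, `B` of size `n`
has a connected matching of size `n` if and only if the complement of `G` has an
acyclic colouring with `n` colours. -/
theorem stmt_6 {V : Type*} [Fintype V] [DecidableEq V] (G : SimpleGraph V) (n : ℕ)
    (A B : Finset V) (hdisj : Disjoint A B) (hunion : A ∪ B = Finset.univ)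
    (hA : A.card = n) (hB : B.card = n)
    (hAind : ∀ a ∈ A, ∀ a' ∈ A, ¬G.Adj a a')
    (hBind : ∀ b ∈ B, ∀ b' ∈ B, ¬G.Adj b b') :
    (∃ M : Finset (Sym2 V), (∀ e ∈ M, e ∈ G.edgeSet) ∧ M.card = n ∧
      (∀ e ∈ M, ∀ f ∈ M, e ≠ f → ∀ v : V, ¬(v ∈ e ∧ v ∈ f)) ∧
      (∀ e ∈ M, ∀ f ∈ M, e ≠ f → ∃ x y : V, x ∈ e ∧ y ∈ f ∧ G.Adj x y))
    ↔ (∃ c : V → Fin n, (∀ u v, Gᶜ.Adj u v → c u ≠ c v) ∧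
        ∀ i j : Fin n, i ≠ j → (Gᶜ.induce {v : V | c v = i ∨ c v = j}).IsAcyclic) := by
  have hV : Fintype.card V = 2 * n := by
    rw [← Finset.card_univ, ← hunion, Finset.card_union_of_disjoint hdisj, hA, hB, two_mul]
  constructor
  · rintro ⟨M, hM, hMn, hdis, hcon⟩
    choose e heM hve using G.exists_mem_of_matching_card M hM hdis (by rw [hMn, hV])
    let φ : M ≃ Fin n := Finset.equivFinOfCardEq hMn
    have hc : ∀ u (i : Fin n), φ ⟨e u, heM u⟩ = i → u ∈ (φ.symm i : Sym2 V) := by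
      rintro u i rfl
      simpa using hve u
    refine ⟨fun v => φ ⟨e v, heM v⟩, fun u v huv h => ?_, fun i j hij => ?_⟩
    · have heq : e u = e v := by simpa using h
      have huve : e u = s(u, v) :=
        (Sym2.mem_and_mem_iff huv.ne).mp ⟨hve u, heq ▸ hve v⟩
      exact ((SimpleGraph.compl_adj _ _ _).mp huv).2
        ((SimpleGraph.mem_edgeSet _).mp (huve ▸ hM _ (heM u)))
    · have hne : (φ.symm i : Sym2 V) ≠ φ.symm j := fun h =>
        hij (φ.symm.injective (Subtype.ext h))
      obtain ⟨x, y, hx, hy, hxy⟩ := hcon _ (φ.symm i).2 _ (φ.symm j).2 hne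
      obtain ⟨x', hx'⟩ := Sym2.mem_iff_exists.mp hx
      obtain ⟨y', hy'⟩ := Sym2.mem_iff_exists.mp hy
      have hxx : G.Adj x x' := (G.mem_edgeSet).mp (hx' ▸ hM _ (φ.symm i).2)
      have hyy : G.Adj y y' := (G.mem_edgeSet).mp (hy' ▸ hM _ (φ.symm j).2)
      refine Gᶜ.isAcyclic_induce_of_four (x := x) (x' := x') (y := y) (y' := y') _ ?_ ?_ ?_ ?_
      · rintro v (hv | hv)
        · have := hc v i hv
          rw [hx', Sym2.mem_iff] at this
          tauto
        · have := hc v j hv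
          rw [hy', Sym2.mem_iff] at this
          tauto
      all_goals simp [SimpleGraph.compl_adj, *]
  · rintro ⟨c, hproper, hacyc⟩
    have hsame : ∀ u v, u ≠ v → c u = c v → G.Adj u v := fun u v huv h => by
      by_contra hG
      exact hproper u v ((SimpleGraph.compl_adj _ _ _).mpr ⟨huv, hG⟩) h
    have hsel : ∀ S : Finset V, S.card = n → (∀ s ∈ S, ∀ s' ∈ S, ¬G.Adj s s') →
        ∀ i, ∃ s ∈ S, c s = i := by
      intro S hS hind i
      have himg : S.image c = Finset.univ := by
        rw [← Finset.card_eq_iff_eq_univ, Finset.card_image_of_injOn, hS, Fintype.card_fin]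
        intro s hs s' hs' h
        by_contra hne
        exact hind s hs s' hs' (hsame s s' hne h)
      simpa using himg.ge (Finset.mem_univ i)
    choose a haA hac using hsel A hA hAind
    choose b hbB hbc using hsel B hB hBind
    have hab : ∀ i j, a i ≠ b j := fun i j h =>
      Finset.disjoint_left.mp hdisj (haA i) (h ▸ hbB j)
    have hcol : ∀ i v, v ∈ s(a i, b i) → c v = i := by
      intro i v hv
      rcases Sym2.mem_iff.mp hv with rfl | rfl
      · exact hac i
      · exact hbc i
    have hinj : Function.Injective fun i => s(a i, b i) := fun i j h => by
      have h' : a i ∈ s(a j, b j) := by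
        rw [← show s(a i, b i) = s(a j, b j) from h]
        exact Sym2.mem_mk_left _ _
      rw [← hac i, hcol j _ h']
    refine ⟨Finset.univ.image fun i => s(a i, b i), ?_, ?_, ?_, ?_⟩
    · simp only [Finset.mem_image, Finset.mem_univ, true_and]
      rintro _ ⟨i, rfl⟩
      exact hsame _ _ (hab i i) ((hac i).trans (hbc i).symm)
    · rw [Finset.card_image_of_injective _ hinj, Finset.card_univ, Fintype.card_fin]
    · simp only [Finset.mem_image, Finset.mem_univ, true_and]
      rintro _ ⟨i, rfl⟩ _ ⟨j, rfl⟩ hij v ⟨hvi, hvj⟩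
      exact hij (by rw [← hcol i v hvi, hcol j v hvj])
    · simp only [Finset.mem_image, Finset.mem_univ, true_and]
      rintro _ ⟨i, rfl⟩ _ ⟨j, rfl⟩ hij'
      have hij : i ≠ j := fun h => hij' (by rw [h])
      by_contra! hno
      have h1 := hno (a i) (b j) (Sym2.mem_mk_left _ _) (Sym2.mem_mk_right _ _)
      have h2 := hno (b i) (a j) (Sym2.mem_mk_right _ _) (Sym2.mem_mk_left _ _)
      have haij : a i ≠ a j := fun h => hij (by rw [← hac i, h, hac j])
      have hbij : b i ≠ b j := fun h => hij (by rw [← hbc i, h, hbc j])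
      refine (hacyc i j hij).not_four_cycle (a := ⟨a i, .inl (hac i)⟩) (b := ⟨a j, .inr (hac j)⟩)
        (c := ⟨b i, .inl (hbc i)⟩) (d := ⟨b j, .inr (hbc j)⟩) ?_ ?_ ?_ ?_ ?_ ?_
      · exact (SimpleGraph.compl_adj _ _ _).mpr ⟨haij, hAind _ (haA i) _ (haA j)⟩
      · exact (SimpleGraph.compl_adj _ _ _).mpr ⟨hab j i, fun h => h2 h.symm⟩
      · exact (SimpleGraph.compl_adj _ _ _).mpr ⟨hbij, hBind _ (hbB i) _ (hbB j)⟩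
      · exact (SimpleGraph.compl_adj _ _ _).mpr ⟨(hab i j).symm, fun h => h1 h.symm⟩
      · exact fun h => hab i i (congrArg Subtype.val h)
      · exact fun h => hab j j (congrArg Subtype.val h)
end

section
/- Let G be a finite simple graph and let k ≥ 1 and m ≥ 1 be integers. Let G' be the join of G with a complete graph on m new vertices, i.e., G' is obtained from the disjoint union of G and K_m by adding all edges between V(G) and the m new vertices. Then G has a star k-colouring if and only if G' has a star (k+m)-colouring. -/
/-- A graph is a star forest if every connected component is a star: each
component has a centre `z` such that two vertices of the component are adjacent
iff they are distinct and one of them is `z`. -/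
def IsStarForest {W : Type*} (H : SimpleGraph W) : Prop :=
  ∀ v : W, ∃ z : W, H.Reachable v z ∧
    ∀ a b : W, H.Reachable v a → H.Reachable v b →
      (H.Adj a b ↔ (a = z ∨ b = z) ∧ a ≠ b)

theorem IsStarForest.of_iso {W W' : Type*} {H : SimpleGraph W} {H' : SimpleGraph W'}
    (e : H ≃g H') (h : IsStarForest H) : IsStarForest H' := by
  intro v
  obtain ⟨z, hz, hs⟩ := h (e.symm v)
  refine ⟨e z, e.symm.reachable_iff.1 (by simpa using hz), fun a b ha hb => ?_⟩
  have := hs (e.symm a) (e.symm b) (e.symm.reachable_iff.2 ha) (e.symm.reachable_iff.2 hb)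
  rw [e.symm.map_adj_iff] at this
  have key : ∀ x, e.symm x = z ↔ x = e z := fun x => e.toEquiv.symm_apply_eq
  rw [this, key, key, Ne, Ne, e.symm.injective.eq_iff]

/-- A graph in which the edges are exactly the pairs of distinct vertices containing `z` is
a star forest. -/
theorem IsStarForest.of_center {W : Type*} {H : SimpleGraph W} (z : W)
    (h : ∀ a b, H.Adj a b ↔ (a = z ∨ b = z) ∧ a ≠ b) : IsStarForest H := by
  intro v
  refine ⟨z, ?_, fun a b _ _ => h a b⟩
  by_cases hv : v = z
  · rw [hv]
  · exact ((h v z).2 ⟨Or.inr rfl, hv⟩).reachable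

/-- An embedding restricts to an isomorphism between the graphs induced by a subset of its
range and by the preimage of that subset. -/
theorem SimpleGraph.Embedding.nonempty_induce_preimage_iso {V W : Type*} {G : SimpleGraph V}
    {G' : SimpleGraph W} (f : G ↪g G') {S : Set V} {T : Set W}
    (hS : ∀ v, f v ∈ T ↔ v ∈ S) (hT : T ⊆ Set.range f) :
    Nonempty (G.induce S ≃g G'.induce T) := by
  refine ⟨⟨Equiv.ofBijective (fun v => ⟨f v, (hS v).2 v.2⟩) ⟨?_, ?_⟩, ?_⟩⟩
  · intro a b hab
    exact Subtype.ext (f.injective (congrArg Subtype.val hab))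
  · rintro ⟨w, hw⟩
    obtain ⟨v, rfl⟩ := hT hw
    exact ⟨⟨v, (hS v).1 hw⟩, rfl⟩
  · intro a b
    exact f.map_adj_iff

/-- If a colour of a proper colouring is used on a single vertex `z`, which is adjacent to all
other vertices, then together with any other colour it induces a star forest. -/
theorem isStarForest_induce_of_dominating {W C : Type*} {H : SimpleGraph W} {c : W → C}
    (hc : ∀ a b, H.Adj a b → c a ≠ c b) {z : W} (hz : ∀ a, a ≠ z → H.Adj a z)
    (hu : ∀ a, c a = c z → a = z) (j : C) :
    IsStarForest (H.induce {w | c w = c z ∨ c w = j}) := by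
  refine IsStarForest.of_center ⟨z, Or.inl rfl⟩ ?_
  rintro ⟨a, ha⟩ ⟨b, hb⟩
  simp only [SimpleGraph.comap_adj, Function.Embedding.subtype_apply, Subtype.mk.injEq, ne_eq]
  constructor
  · intro hab
    refine ⟨?_, hab.ne⟩
    by_contra! hne
    exact hc a b hab ((ha.resolve_left (mt (hu a) hne.1)).trans
      (hb.resolve_left (mt (hu b) hne.2)).symm)
  · rintro ⟨rfl | rfl, hne⟩
    · exact (hz b (Ne.symm hne)).symm
    · exact hz a hne

/-- Let `G'` be the join of a finite simple graph `G` with a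
complete graph on `m` new vertices. Then `G` has a star `k`-colouring if and
only if `G'` has a star `(k+m)`-colouring. -/
theorem stmt_8 {V : Type*} [Fintype V] (G : SimpleGraph V) (k m : ℕ)
    (hk : 1 ≤ k) (hm : 1 ≤ m)
    (G' : SimpleGraph (V ⊕ Fin m))
    (hVV : ∀ u v : V, G'.Adj (Sum.inl u) (Sum.inl v) ↔ G.Adj u v)
    (hKK : ∀ i j : Fin m, G'.Adj (Sum.inr i) (Sum.inr j) ↔ i ≠ j)
    (hVK : ∀ (u : V) (i : Fin m), G'.Adj (Sum.inl u) (Sum.inr i)) :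
    (∃ c : V → Fin k, (∀ u v, G.Adj u v → c u ≠ c v) ∧
      ∀ i j : Fin k, i ≠ j → IsStarForest (G.induce {v : V | c v = i ∨ c v = j}))
    ↔ (∃ c' : V ⊕ Fin m → Fin (k + m), (∀ a b, G'.Adj a b → c' a ≠ c' b) ∧
      ∀ i j : Fin (k + m), i ≠ j →
        IsStarForest (G'.induce {w : V ⊕ Fin m | c' w = i ∨ c' w = j})) := by
  let f : G ↪g G' := ⟨Function.Embedding.inl, hVV _ _⟩
  constructor
  · rintro ⟨c, hc, hs⟩
    let c' : V ⊕ Fin m → Fin (k + m) := Sum.elim (fun v => Fin.castAdd m (c v)) (Fin.natAdd k)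
    have hne : ∀ (x : Fin k) (y : Fin m), Fin.castAdd m x ≠ Fin.natAdd k y := fun x y h => by
      have := congrArg Fin.val h
      simp only [Fin.val_castAdd, Fin.val_natAdd] at this
      omega
    have hc' : ∀ a b, G'.Adj a b → c' a ≠ c' b := by
      rintro (u | p) (v | q) hab
      · exact fun h => hc u v ((hVV u v).1 hab) (Fin.castAdd_injective k m h)
      · exact hne _ _
      · exact (hne _ _).symm
      · exact fun h => (hKK p q).1 hab (Fin.natAdd_injective m k h)
    have hstar : ∀ (p : Fin m) (j : Fin (k + m)),
        IsStarForest (G'.induce {w | c' w = Fin.natAdd k p ∨ c' w = j}) := by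
      intro p j
      refine isStarForest_induce_of_dominating (z := Sum.inr p) hc' ?_ ?_ j
      · rintro (u | q) h
        · exact hVK u p
        · exact (hKK q p).2 fun e => h (congrArg _ e)
      · rintro (u | q) h
        · exact absurd h (hne _ _)
        · exact congrArg _ (Fin.natAdd_injective m k h)
    refine ⟨c', hc', fun i j hij => ?_⟩
    induction i using Fin.addCases with
    | right p => exact hstar p j
    | left i =>
      induction j using Fin.addCases with
      | right q =>
        rw [Set.ofPred_or, Set.union_comm]
        exact hstar q (Fin.castAdd m i)
      | left j =>
        obtain ⟨e⟩ := f.nonempty_induce_preimage_iso (S := {v | c v = i ∨ c v = j})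
          (T := {w | c' w = Fin.castAdd m i ∨ c' w = Fin.castAdd m j})
          (fun v => or_congr (Fin.castAdd_injective k m).eq_iff
            (Fin.castAdd_injective k m).eq_iff)
          (by
            rintro (v | q) hw
            · exact ⟨v, rfl⟩
            · exact (hw.elim (hne _ _).symm (hne _ _).symm).elim)
        exact (hs i j fun h => hij (congrArg _ h)).of_iso e
  · rintro ⟨c', hc', hs⟩
    have hinj : Function.Injective fun p : Fin m => c' (Sum.inr p) := fun p q h => by
      by_contra hpq
      exact hc' _ _ ((hKK p q).2 hpq) h
    let R : Set (Fin (k + m)) := Set.range fun p : Fin m => c' (Sum.inr p)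
    have hcard : Nat.card (Rᶜ : Set _) = k := by
      have h₁ : R.ncard = m := by
        rw [← Nat.card_coe_set_eq, Nat.card_range_of_injective hinj, Nat.card_fin]
      have h₂ := Set.ncard_add_ncard_compl R
      rw [Nat.card_fin] at h₂
      rw [Nat.card_coe_set_eq]
      omega
    let σ : (Rᶜ : Set _) ≃ Fin k := Finite.equivFinOfCardEq hcard
    have hR : ∀ v, c' (Sum.inl v) ∈ Rᶜ := by
      rintro v ⟨p, hp⟩
      exact hc' _ _ (hVK v p) hp.symm
    have hσ : ∀ v i, c' (Sum.inl v) = σ.symm i ↔ σ ⟨c' (Sum.inl v), hR v⟩ = i := fun v i => by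
      rw [← Equiv.eq_symm_apply, Subtype.ext_iff]
    refine ⟨fun v => σ ⟨c' (Sum.inl v), hR v⟩, fun u v huv h => ?_, fun i j hij => ?_⟩
    · exact hc' _ _ ((hVV u v).2 huv) (congrArg Subtype.val (σ.injective h))
    · obtain ⟨e⟩ := f.nonempty_induce_preimage_iso
        (S := {v | σ ⟨c' (Sum.inl v), hR v⟩ = i ∨ σ ⟨c' (Sum.inl v), hR v⟩ = j})
        (T := {w | c' w = σ.symm i ∨ c' w = σ.symm j})
        (fun v => or_congr (hσ v i) (hσ v j))
        (by
          rintro (v | q) hw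
          · exact ⟨v, rfl⟩
          · exact (hw.elim (fun h => (σ.symm i).2 ⟨q, h⟩) fun h => (σ.symm j).2 ⟨q, h⟩).elim)
      exact (hs _ _ fun h => hij (σ.symm.injective (Subtype.ext h))).of_iso e.symm
end

section
/- Let G be a finite connected P_4-free graph. Then every injective colouring of G assigns pairwise distinct colours to all vertices of G; consequently, the minimum number of colours in an injective colouring of G equals the number of vertices of G. -/
/-- In a graph without induced `P₄`, reachable vertices are at distance at most two. -/
theorem SimpleGraph.Walk.eq_or_adj_or_exists_adj_adj_of_P4_free {V : Type*} {G : SimpleGraph V}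
    (hP4free : ∀ v1 v2 v3 v4 : V,
      v1 ≠ v2 → v1 ≠ v3 → v1 ≠ v4 → v2 ≠ v3 → v2 ≠ v4 → v3 ≠ v4 →
      ¬(G.Adj v1 v2 ∧ G.Adj v2 v3 ∧ G.Adj v3 v4 ∧
        ¬G.Adj v1 v3 ∧ ¬G.Adj v1 v4 ∧ ¬G.Adj v2 v4))
    {u v : V} (p : G.Walk u v) :
    u = v ∨ G.Adj u v ∨ ∃ w, G.Adj u w ∧ G.Adj w v := by
  induction p with
  | nil => exact Or.inl rfl
  | @cons u w v huw _ ih =>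
    rcases ih with rfl | hwv | ⟨x, hwx, hxv⟩
    · exact Or.inr (Or.inl huw)
    · exact Or.inr (Or.inr ⟨w, huw, hwv⟩)
    · by_contra! ⟨huv, hnuv, hno⟩
      have hux : ¬G.Adj u x := fun h => hno x h hxv
      have hwv : ¬G.Adj w v := hno w huw
      refine hP4free u w x v huw.ne ?_ huv hwx.ne ?_ hxv.ne ⟨huw, hwx, hxv, hux, hnuv, hwv⟩
      · rintro rfl
        exact hnuv hxv
      · rintro rfl
        exact hnuv huw

/-- An injective colouring of a connected graph without induced `P₄` is an injective function. -/
theorem SimpleGraph.Connected.injective_of_injOn_neighborSet_of_P4_free {V α : Type*}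
    {G : SimpleGraph V} (hconn : G.Connected)
    (hP4free : ∀ v1 v2 v3 v4 : V,
      v1 ≠ v2 → v1 ≠ v3 → v1 ≠ v4 → v2 ≠ v3 → v2 ≠ v4 → v3 ≠ v4 →
      ¬(G.Adj v1 v2 ∧ G.Adj v2 v3 ∧ G.Adj v3 v4 ∧
        ¬G.Adj v1 v3 ∧ ¬G.Adj v1 v4 ∧ ¬G.Adj v2 v4))
    {c : V → α} (hc : ∀ u v, G.Adj u v → c u ≠ c v)
    (hinj : ∀ v, Set.InjOn c (G.neighborSet v)) : Function.Injective c := by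
  intro u v huv
  obtain ⟨p⟩ := hconn.preconnected u v
  rcases p.eq_or_adj_or_exists_adj_adj_of_P4_free hP4free with h | h | ⟨w, huw, hwv⟩
  · exact h
  · exact absurd huv (hc u v h)
  · exact hinj w huw.symm hwv huv

/-- In a finite connected `P₄`-free graph, every injective
colouring assigns pairwise distinct colours to all vertices; consequently, the
minimum number of colours in an injective colouring equals the number of
vertices. -/
theorem stmt_10 {V : Type*} [Fintype V] (G : SimpleGraph V)
    (hconn : G.Connected)
    (hP4free : ∀ v1 v2 v3 v4 : V,
      v1 ≠ v2 → v1 ≠ v3 → v1 ≠ v4 → v2 ≠ v3 → v2 ≠ v4 → v3 ≠ v4 →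
      ¬(G.Adj v1 v2 ∧ G.Adj v2 v3 ∧ G.Adj v3 v4 ∧
        ¬G.Adj v1 v3 ∧ ¬G.Adj v1 v4 ∧ ¬G.Adj v2 v4)) :
    (∀ c : V → ℕ, (∀ u v, G.Adj u v → c u ≠ c v) →
      (∀ v, Set.InjOn c (G.neighborSet v)) → Function.Injective c)
    ∧ IsLeast {k : ℕ | ∃ c : V → Fin k, (∀ u v, G.Adj u v → c u ≠ c v) ∧
        ∀ v, Set.InjOn c (G.neighborSet v)} (Fintype.card V) := by
  refine ⟨fun c => hconn.injective_of_injOn_neighborSet_of_P4_free hP4free,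
    ⟨Fintype.equivFin V, fun u v h => (Fintype.equivFin V).injective.ne h.ne,
      fun v => (Fintype.equivFin V).injective.injOn⟩, ?_⟩
  rintro k ⟨c, hc, hinj⟩
  simpa using Fintype.card_le_of_injective c
    (hconn.injective_of_injOn_neighborSet_of_P4_free hP4free hc hinj)
end

section
/- Let G be a finite (P_1+P_4)-free graph that contains an induced P_4. Then every colour class of every injective colouring of G has size at most 2. -/
/-- In a `(P₁+P₄)`-free graph with three vertices of one colour in an injective colouring, two of them
cannot dominate the two ends of an edge: otherwise they extend it to an induced `P₄` missed by the
third. -/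
lemma not_dominate_edge_of_three_of_same_color {V : Type*} (G : SimpleGraph V)
    (hfree : ∀ x v1 v2 v3 v4 : V,
      x ≠ v1 → x ≠ v2 → x ≠ v3 → x ≠ v4 →
      v1 ≠ v2 → v1 ≠ v3 → v1 ≠ v4 → v2 ≠ v3 → v2 ≠ v4 → v3 ≠ v4 →
      ¬(G.Adj v1 v2 ∧ G.Adj v2 v3 ∧ G.Adj v3 v4 ∧
        ¬G.Adj v1 v3 ∧ ¬G.Adj v1 v4 ∧ ¬G.Adj v2 v4 ∧
        ¬G.Adj x v1 ∧ ¬G.Adj x v2 ∧ ¬G.Adj x v3 ∧ ¬G.Adj x v4))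
    (c : V → ℕ) (hproper : ∀ u v, G.Adj u v → c u ≠ c v)
    (hinj : ∀ v, Set.InjOn c (G.neighborSet v))
    {x y z : V} (hxy : x ≠ y) (hxz : x ≠ z) (hyz : y ≠ z) (hcxy : c x = c y) (hcxz : c x = c z)
    {a b : V} (hab : G.Adj a b) (hya : y = a ∨ G.Adj y a) (hzb : z = b ∨ G.Adj z b) : False := by
  have common : ∀ u w v, G.Adj u v → G.Adj w v → c u = c w → u = w :=
    fun u w v hu hw h => hinj v hu.symm hw.symm h
  have hcyz : c y = c z := hcxy.symm.trans hcxz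
  rcases hya with rfl | hya <;> rcases hzb with rfl | hzb
  · exact hproper _ _ hab hcyz
  · exact hyz (common _ _ _ hab hzb hcyz)
  · exact hyz (common _ _ _ hya hab.symm hcyz)
  · have hxa : ¬G.Adj x a := fun h => hxy (common _ _ _ h hya hcxy)
    have hxb : ¬G.Adj x b := fun h => hxz (common _ _ _ h hzb hcxz)
    have hyb : ¬G.Adj y b := fun h => hyz (common _ _ _ h hzb hcyz)
    have hza : ¬G.Adj a z := fun h => hyz (common _ _ _ hya h.symm hcyz)
    refine hfree x y a b z hxy ?_ ?_ hxz hya.ne ?_ hyz hab.ne ?_ hzb.ne.symm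
      ⟨hya, hab, hzb.symm, hyb, fun h => hproper _ _ h hcyz, hza,
        fun h => hproper _ _ h hcxy, hxa, hxb, fun h => hproper _ _ h hcxz⟩
    · rintro rfl
      exact hproper _ _ hya hcxy.symm
    · rintro rfl
      exact hproper _ _ hzb hcxz.symm
    · rintro rfl
      exact hproper _ _ hzb hcyz.symm
    · rintro rfl
      exact hproper _ _ hya hcyz


/-- In a finite `(P₁+P₄)`-free graph containing an induced `P₄`,
every colour class of every injective colouring has size at most 2. -/
theorem stmt_11 {V : Type*} [Fintype V] (G : SimpleGraph V)
    (hfree : ∀ x v1 v2 v3 v4 : V,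
      x ≠ v1 → x ≠ v2 → x ≠ v3 → x ≠ v4 →
      v1 ≠ v2 → v1 ≠ v3 → v1 ≠ v4 → v2 ≠ v3 → v2 ≠ v4 → v3 ≠ v4 →
      ¬(G.Adj v1 v2 ∧ G.Adj v2 v3 ∧ G.Adj v3 v4 ∧
        ¬G.Adj v1 v3 ∧ ¬G.Adj v1 v4 ∧ ¬G.Adj v2 v4 ∧
        ¬G.Adj x v1 ∧ ¬G.Adj x v2 ∧ ¬G.Adj x v3 ∧ ¬G.Adj x v4))
    (hP4 : ∃ v1 v2 v3 v4 : V,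
      v1 ≠ v2 ∧ v1 ≠ v3 ∧ v1 ≠ v4 ∧ v2 ≠ v3 ∧ v2 ≠ v4 ∧ v3 ≠ v4 ∧
      G.Adj v1 v2 ∧ G.Adj v2 v3 ∧ G.Adj v3 v4 ∧
      ¬G.Adj v1 v3 ∧ ¬G.Adj v1 v4 ∧ ¬G.Adj v2 v4)
    (c : V → ℕ)
    (hproper : ∀ u v, G.Adj u v → c u ≠ c v)
    (hinj : ∀ v, Set.InjOn c (G.neighborSet v)) :
    ∀ i : ℕ, ({v : V | c v = i}).ncard ≤ 2 := by
  intro i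
  by_contra! hcard
  obtain ⟨x, y, z, hx, hy, hz, hxy, hxz, hyz⟩ := (Set.two_lt_ncard_iff (Set.toFinite _)).1 hcard
  simp only [Set.mem_ofPred_eq] at hx hy hz
  obtain ⟨v1, v2, v3, v4, h12, h13, h14, h23, h24, h34, a12, a23, a34, n13, n14, n24⟩ := hP4
  have dom : ∀ u, (u = v1 ∨ G.Adj u v1) ∨ (u = v2 ∨ G.Adj u v2) ∨
      (u = v3 ∨ G.Adj u v3) ∨ (u = v4 ∨ G.Adj u v4) := by
    intro u
    have := hfree u v1 v2 v3 v4
    tauto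
  have unique : ∀ u w v, c u = i → c w = i → u ≠ w → (u = v ∨ G.Adj u v) →
      (w = v ∨ G.Adj w v) → False := by
    rintro u w v hu hw huw (rfl | huv) (rfl | hwv)
    · exact huw rfl
    · exact hproper _ _ hwv (hw.trans hu.symm)
    · exact hproper _ _ huv (hu.trans hw.symm)
    · exact huw (hinj v huv.symm hwv.symm (hu.trans hw.symm))
  have edge : ∀ a b, G.Adj a b → ∀ u w, (u = x ∨ u = y ∨ u = z) → (w = x ∨ w = y ∨ w = z) →
      u ≠ w → (u = a ∨ G.Adj u a) → (w = b ∨ G.Adj w b) → False := by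
    intro a b hab u w hu hw huw hua hwb
    obtain ⟨t, htu, htw, ht⟩ : ∃ t, t ≠ u ∧ t ≠ w ∧ c t = i := by
      rcases hu with rfl | rfl | rfl <;> rcases hw with rfl | rfl | rfl <;> grind
    have hcu : c u = i := by rcases hu with rfl | rfl | rfl <;> assumption
    have hcw : c w = i := by rcases hw with rfl | rfl | rfl <;> assumption
    exact not_dominate_edge_of_three_of_same_color G hfree c hproper hinj htu htw huw
      (ht.trans hcu.symm) (ht.trans hcw.symm) hab hua hwb
  have uxy := fun v => unique x y v hx hy hxy
  have uxz := fun v => unique x z v hx hz hxz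
  have uyz := fun v => unique y z v hy hz hyz
  have exy := fun a b h => edge a b h x y (by simp) (by simp) hxy
  have exz := fun a b h => edge a b h x z (by simp) (by simp) hxz
  have eyz := fun a b h => edge a b h y z (by simp) (by simp) hyz
  rcases dom x with dx | dx | dx | dx <;> rcases dom y with dy | dy | dy | dy <;>
    first
    | exact uxy _ dx dy
    | exact exy _ _ (by assumption) dx dy
    | exact exy _ _ (SimpleGraph.Adj.symm (by assumption)) dx dy
    | rcases dom z with dz | dz | dz | dz <;>
      first
      | exact uxz _ dx dz
      | exact uyz _ dy dz
      | exact exz _ _ (by assumption) dx dz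
      | exact exz _ _ (SimpleGraph.Adj.symm (by assumption)) dx dz
      | exact eyz _ _ (by assumption) dy dz
      | exact eyz _ _ (SimpleGraph.Adj.symm (by assumption)) dy dz
end

section
/- Let G be a finite 4P_1-free graph, let c be an injective colouring of G, and let u_1, u_2, u_3 be three distinct vertices with c(u_1) = c(u_2) = c(u_3). Then {u_1, u_2, u_3} is an independent set, every vertex of G outside {u_1, u_2, u_3} is adjacent to exactly one of u_1, u_2, u_3, and, setting T_i to be the set of vertices outside {u_1,u_2,u_3} adjacent to u_i, each set T_i ∪ {u_i} is a clique; hence V(G) is partitioned into the three cliques T_1 ∪ {u_1}, T_2 ∪ {u_2}, T_3 ∪ {u_3}. -/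
/-- In a finite `4P₁`-free graph with an injective colouring `c`
and three distinct vertices `u₁, u₂, u₃` of the same colour: `{u₁,u₂,u₃}` is
independent, every other vertex is adjacent to exactly one of them, and each
set `T_i ∪ {u_i}` (where `T_i` is the set of other vertices adjacent to `u_i`)
is a clique. -/
theorem stmt_12 {V : Type*} [Fintype V] (G : SimpleGraph V)
    (hfree : ∀ a b c d : V, a ≠ b → a ≠ c → a ≠ d → b ≠ c → b ≠ d → c ≠ d →
      G.Adj a b ∨ G.Adj a c ∨ G.Adj a d ∨ G.Adj b c ∨ G.Adj b d ∨ G.Adj c d)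
    (c : V → ℕ)
    (hproper : ∀ u v, G.Adj u v → c u ≠ c v)
    (hinj : ∀ v, Set.InjOn c (G.neighborSet v))
    (u1 u2 u3 : V) (h12 : u1 ≠ u2) (h13 : u1 ≠ u3) (h23 : u2 ≠ u3)
    (hc12 : c u1 = c u2) (hc13 : c u1 = c u3) :
    (¬G.Adj u1 u2 ∧ ¬G.Adj u1 u3 ∧ ¬G.Adj u2 u3)
    ∧ (∀ v : V, v ≠ u1 → v ≠ u2 → v ≠ u3 →
        (G.Adj v u1 ∧ ¬G.Adj v u2 ∧ ¬G.Adj v u3) ∨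
        (¬G.Adj v u1 ∧ G.Adj v u2 ∧ ¬G.Adj v u3) ∨
        (¬G.Adj v u1 ∧ ¬G.Adj v u2 ∧ G.Adj v u3))
    ∧ (∀ v w : V, v ≠ w →
        v ≠ u1 → v ≠ u2 → v ≠ u3 → w ≠ u1 → w ≠ u2 → w ≠ u3 →
        (G.Adj v u1 → G.Adj w u1 → G.Adj v w) ∧
        (G.Adj v u2 → G.Adj w u2 → G.Adj v w) ∧
        (G.Adj v u3 → G.Adj w u3 → G.Adj v w)) := by
  have n12 : ¬G.Adj u1 u2 := fun h => hproper _ _ h hc12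
  have n13 : ¬G.Adj u1 u3 := fun h => hproper _ _ h hc13
  have n23 : ¬G.Adj u2 u3 := fun h => hproper _ _ h (hc12.symm.trans hc13)
  have e12 (v : V) (h1 : G.Adj v u1) (h2 : G.Adj v u2) : False := h12 (hinj v h1 h2 hc12)
  have e13 (v : V) (h1 : G.Adj v u1) (h3 : G.Adj v u3) : False := h13 (hinj v h1 h3 hc13)
  have e23 (v : V) (h2 : G.Adj v u2) (h3 : G.Adj v u3) : False :=
    h23 (hinj v h2 h3 (hc12.symm.trans hc13))
  refine ⟨⟨n12, n13, n23⟩, fun v hv1 hv2 hv3 => ?_,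
    fun v w hvw hv1 hv2 hv3 hw1 hw2 hw3 => ⟨fun hv hw => ?_, fun hv hw => ?_, fun hv hw => ?_⟩⟩
  · have := hfree v u1 u2 u3 hv1 hv2 hv3 h12 h13 h23
    have := e12 v
    have := e13 v
    have := e23 v
    tauto
  · have := hfree v w u2 u3 hvw hv2 hv3 hw2 hw3 h23
    have := e12 v hv
    have := e13 v hv
    have := e12 w hw
    have := e13 w hw
    tauto
  · have := hfree v w u1 u3 hvw hv1 hv3 hw1 hw3 h13
    have := fun h => e12 v h hv
    have := e23 v hv
    have := fun h => e12 w h hw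
    have := e23 w hw
    tauto
  · have := hfree v w u1 u2 hvw hv1 hv2 hw1 hw2 h12
    have := fun h => e13 v h hv
    have := fun h => e23 v h hv
    have := fun h => e13 w h hw
    have := fun h => e23 w h hw
    tauto
end

section
/- Let G be a finite connected (2P_1+P_3)-free graph that contains an induced 4P_1. Then every colour class of every injective colouring of G has size at most 2. -/
namespace SimpleGraph

variable {V : Type*} {G : SimpleGraph V}

/-- `G` contains no induced `2P₁ + P₃`. -/
def TwoPOneAddPThreeFree (G : SimpleGraph V) : Prop :=
  ∀ x y a b d : V,
    x ≠ y → x ≠ a → x ≠ b → x ≠ d → y ≠ a → y ≠ b → y ≠ d → a ≠ b → a ≠ d → b ≠ d →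
    ¬(G.Adj a b ∧ G.Adj b d ∧ ¬G.Adj a d ∧ ¬G.Adj x y ∧
      ¬G.Adj x a ∧ ¬G.Adj x b ∧ ¬G.Adj x d ∧
      ¬G.Adj y a ∧ ¬G.Adj y b ∧ ¬G.Adj y d)

/-- Distinct vertices `p` and `q` that are neither adjacent nor have a common neighbour. -/
structure Far (G : SimpleGraph V) (p q : V) : Prop where
  ne : p ≠ q
  not_adj : ¬G.Adj p q
  not_adj_of_adj : ∀ v, G.Adj p v → ¬G.Adj q v

theorem Far.symm {p q : V} (h : G.Far p q) : G.Far q p :=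
  ⟨h.ne.symm, fun e => h.not_adj e.symm, fun v hq hp => h.not_adj_of_adj v hp hq⟩

theorem TwoPOneAddPThreeFree.adj_of_closed_nbhd (hG : G.TwoPOneAddPThreeFree) {p q r : V}
    (hpq : G.Far p q) (hpr : G.Far p r) (hqr : G.Far q r) {a b : V}
    (ha : a = p ∨ G.Adj p a) (hb : b = p ∨ G.Adj p b) (hab : a ≠ b) : G.Adj a b := by
  rcases ha with rfl | ha
  · exact hb.resolve_left hab.symm
  rcases hb with rfl | hb
  · exact ha.symm
  by_contra hn
  have ne_of_adj {s v : V} (hs : G.Far p s) (hv : G.Adj p v) : s ≠ v := by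
    rintro rfl
    exact hs.not_adj hv
  exact hG q r a p b hqr.ne (ne_of_adj hpq ha) hpq.ne.symm (ne_of_adj hpq hb)
    (ne_of_adj hpr ha) hpr.ne.symm (ne_of_adj hpr hb) ha.ne' hab hb.ne
    ⟨ha.symm, hb, hn, hqr.not_adj, hpq.not_adj_of_adj a ha, hpq.symm.not_adj,
      hpq.not_adj_of_adj b hb, hpr.not_adj_of_adj a ha, hpr.symm.not_adj,
      hpr.not_adj_of_adj b hb⟩

theorem TwoPOneAddPThreeFree.mem_closed_nbhds_of_adj (hG : G.TwoPOneAddPThreeFree) {p q r : V}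
    (hpq : G.Far p q) (hpr : G.Far p r) (hqr : G.Far q r) {v w : V}
    (hv : v = p ∨ G.Adj p v) (hvw : G.Adj v w) :
    (w = p ∨ G.Adj p w) ∨ (w = q ∨ G.Adj q w) ∨ (w = r ∨ G.Adj r w) := by
  rcases hv with rfl | hv
  · exact .inl (.inr hvw)
  by_contra! hn
  obtain ⟨⟨hwp, hpw⟩, ⟨hwq, hqw⟩, hwr, hrw⟩ := hn
  have ne_of_far {s : V} (hs : G.Far p s) : s ≠ v := by
    rintro rfl
    exact hs.not_adj hv
  exact hG q r p v w hqr.ne hpq.ne.symm (ne_of_far hpq) hwq.symm hpr.ne.symm (ne_of_far hpr)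
    hwr.symm hv.ne hwp.symm hvw.ne
    ⟨hv, hvw, hpw, hqr.not_adj, hpq.symm.not_adj, hpq.not_adj_of_adj v hv, hqw,
      hpr.symm.not_adj, hpr.not_adj_of_adj v hv, hrw⟩

theorem TwoPOneAddPThreeFree.mem_closed_nbhds (hG : G.TwoPOneAddPThreeFree) (hconn : G.Connected)
    {p q r : V} (hpq : G.Far p q) (hpr : G.Far p r) (hqr : G.Far q r) (v : V) :
    (v = p ∨ G.Adj p v) ∨ (v = q ∨ G.Adj q v) ∨ (v = r ∨ G.Adj r v) := by
  have hv := (reachable_iff_reflTransGen p v).1 (hconn.preconnected p v)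
  induction hv with
  | refl => exact .inl (.inl rfl)
  | tail _ huw ih =>
    rcases ih with h | h | h
    · exact hG.mem_closed_nbhds_of_adj hpq hpr hqr h huw
    · have := hG.mem_closed_nbhds_of_adj hpq.symm hqr hpr h huw
      tauto
    · have := hG.mem_closed_nbhds_of_adj hpr.symm hqr.symm hpq h huw
      tauto

end SimpleGraph


/-- In a finite connected `(2P₁+P₃)`-free graph containing an
induced `4P₁`, every colour class of every injective colouring has size at
most 2. -/
theorem stmt_13 {V : Type*} [Fintype V] (G : SimpleGraph V)
    (hconn : G.Connected)
    (hfree : ∀ x y a b d : V,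
      x ≠ y → x ≠ a → x ≠ b → x ≠ d → y ≠ a → y ≠ b → y ≠ d → a ≠ b → a ≠ d → b ≠ d →
      ¬(G.Adj a b ∧ G.Adj b d ∧ ¬G.Adj a d ∧ ¬G.Adj x y ∧
        ¬G.Adj x a ∧ ¬G.Adj x b ∧ ¬G.Adj x d ∧
        ¬G.Adj y a ∧ ¬G.Adj y b ∧ ¬G.Adj y d))
    (h4P1 : ∃ a b d e : V, a ≠ b ∧ a ≠ d ∧ a ≠ e ∧ b ≠ d ∧ b ≠ e ∧ d ≠ e ∧
      ¬G.Adj a b ∧ ¬G.Adj a d ∧ ¬G.Adj a e ∧ ¬G.Adj b d ∧ ¬G.Adj b e ∧ ¬G.Adj d e)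
    (c : V → ℕ)
    (hproper : ∀ u v, G.Adj u v → c u ≠ c v)
    (hinj : ∀ v, Set.InjOn c (G.neighborSet v)) :
    ∀ i : ℕ, ({v : V | c v = i}).ncard ≤ 2 := by
  intro i
  by_contra! hcard
  obtain ⟨p, q, r, hp, hq, hr, hpq, hpr, hqr⟩ := (Set.two_lt_ncard_iff (Set.toFinite _)).1 hcard
  have far {s t : V} (hs : c s = i) (ht : c t = i) (hst : s ≠ t) : G.Far s t :=
    ⟨hst, fun h => hproper s t h (hs.trans ht.symm), fun v hsv htv =>
      hst (hinj v hsv.symm htv.symm (hs.trans ht.symm))⟩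
  have hpq' := far hp hq hpq
  have hpr' := far hp hr hpr
  have hqr' := far hq hr hqr
  have hG : G.TwoPOneAddPThreeFree := hfree
  obtain ⟨a, b, d, e, hab, had, hae, hbd, hbe, hde, nab, nad, nae, nbd, nbe, nde⟩ := h4P1
  have cover := hG.mem_closed_nbhds hconn hpq' hpr' hqr'
  have cp {x y : V} := @SimpleGraph.TwoPOneAddPThreeFree.adj_of_closed_nbhd V G hG p q r hpq' hpr' hqr' x y
  have cq {x y : V} := @SimpleGraph.TwoPOneAddPThreeFree.adj_of_closed_nbhd V G hG q p r hpq'.symm hqr' hpr' x y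
  have cr {x y : V} := @SimpleGraph.TwoPOneAddPThreeFree.adj_of_closed_nbhd V G hG r p q hpr'.symm hqr'.symm hpq' x y
  rcases cover a with ha | ha | ha <;> rcases cover b with hb | hb | hb <;>
    rcases cover d with hd | hd | hd <;> rcases cover e with he | he | he <;>
    first
    | exact nab (cp ha hb hab) | exact nab (cq ha hb hab) | exact nab (cr ha hb hab)
    | exact nad (cp ha hd had) | exact nad (cq ha hd had) | exact nad (cr ha hd had)
    | exact nae (cp ha he hae) | exact nae (cq ha he hae) | exact nae (cr ha he hae)
    | exact nbd (cp hb hd hbd) | exact nbd (cq hb hd hbd) | exact nbd (cr hb hd hbd)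
    | exact nbe (cp hb he hbe) | exact nbe (cq hb he hbe) | exact nbe (cr hb he hbe)
    | exact nde (cp hd he hde) | exact nde (cq hd he hde) | exact nde (cr hd he hde)
end

section
/- Let G be a finite connected (3P_1+P_2)-free graph. Then every colour class of every injective colouring of G has size at most 3. -/
/-- In a finite connected `(3P₁+P₂)`-free graph, every colour
class of every injective colouring has size at most 3. -/
theorem stmt_14 {V : Type*} [Fintype V] (G : SimpleGraph V)
    (hconn : G.Connected)
    (hfree : ∀ x y z a b : V,
      x ≠ y → x ≠ z → x ≠ a → x ≠ b → y ≠ z → y ≠ a → y ≠ b → z ≠ a → z ≠ b → a ≠ b →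
      ¬(G.Adj a b ∧ ¬G.Adj x y ∧ ¬G.Adj x z ∧ ¬G.Adj y z ∧
        ¬G.Adj x a ∧ ¬G.Adj x b ∧ ¬G.Adj y a ∧ ¬G.Adj y b ∧ ¬G.Adj z a ∧ ¬G.Adj z b))
    (c : V → ℕ)
    (hproper : ∀ u v, G.Adj u v → c u ≠ c v)
    (hinj : ∀ v, Set.InjOn c (G.neighborSet v)) :
    ∀ i : ℕ, ({v : V | c v = i}).ncard ≤ 3 := by
  intro i
  by_contra! h
  obtain ⟨S, hS, hcard⟩ := Set.exists_subset_card_eq (show 4 ≤ _ from h)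
  obtain ⟨a, x, y, z, hax, hay, haz, hxy, hxz, hyz, rfl⟩ := Set.ncard_eq_four.mp hcard
  have ha : c a = i := hS (by simp)
  have hx : c x = i := hS (by simp)
  have hy : c y = i := hS (by simp)
  have hz : c z = i := hS (by simp)
  have : Nontrivial V := ⟨a, x, hax⟩
  obtain ⟨b, hab⟩ := hconn.preconnected.exists_adj_of_nontrivial a
  have indep : ∀ u v, c u = i → c v = i → ¬G.Adj u v :=
    fun u v hu hv huv => hproper u v huv (hu.trans hv.symm)
  have hb : ∀ u, c u = i → u ≠ b :=
    fun u hu h => hproper a b hab (ha.trans (h ▸ hu.symm))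
  have private_nbr : ∀ u, c u = i → a ≠ u → ¬G.Adj u b :=
    fun u hu hau hub => hau (hinj b hab.symm hub.symm (ha.trans hu.symm))
  exact hfree x y z a b hxy hxz hax.symm (hb x hx) hyz hay.symm (hb y hy) haz.symm (hb z hz)
    hab.ne ⟨hab, indep x y hx hy, indep x z hx hz, indep y z hy hz, indep x a hx ha,
      private_nbr x hx hax, indep y a hy ha, private_nbr y hy hay, indep z a hz ha,
      private_nbr z hz haz⟩
end

section
/- Let G be a finite connected (3P_1+P_2)-free graph and let c be an injective colouring of G having a colour class U of size exactly 3. If some vertex of G outside U is adjacent to no vertex of U, then every colour class of c other than U has size exactly 1. -/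
/-- Let `G` be a finite connected `(3P₁+P₂)`-free graph and `c` an
injective colouring of `G` with a colour class `U` (of colour `i₀`) of size
exactly 3. If some vertex outside `U` has no neighbour in `U`, then every other
(nonempty) colour class has size exactly 1. -/
theorem stmt_15 {V : Type*} [Fintype V] (G : SimpleGraph V)
    (hconn : G.Connected)
    (hfree : ∀ x y z a b : V,
      x ≠ y → x ≠ z → x ≠ a → x ≠ b → y ≠ z → y ≠ a → y ≠ b → z ≠ a → z ≠ b → a ≠ b →
      ¬(G.Adj a b ∧ ¬G.Adj x y ∧ ¬G.Adj x z ∧ ¬G.Adj y z ∧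
        ¬G.Adj x a ∧ ¬G.Adj x b ∧ ¬G.Adj y a ∧ ¬G.Adj y b ∧ ¬G.Adj z a ∧ ¬G.Adj z b))
    (c : V → ℕ)
    (hproper : ∀ u v, G.Adj u v → c u ≠ c v)
    (hinj : ∀ v, Set.InjOn c (G.neighborSet v))
    (i₀ : ℕ) (hU : ({v : V | c v = i₀}).ncard = 3)
    (hw : ∃ w : V, c w ≠ i₀ ∧ ∀ u : V, c u = i₀ → ¬G.Adj w u) :
    ∀ j : ℕ, j ≠ i₀ → ({v : V | c v = j}).Nonempty → ({v : V | c v = j}).ncard = 1 := by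
  obtain ⟨p, q, r, hpq, hpr, hqr, hS⟩ := Set.ncard_eq_three.mp hU
  obtain ⟨w, hwc, hwU⟩ := hw
  have hmem (v : V) : c v = i₀ ↔ v = p ∨ v = q ∨ v = r := by
    simpa using Set.ext_iff.mp hS v
  have hcommon {v x y : V} (hx : G.Adj v x) (hy : G.Adj v y) (h : c x = c y) : x = y :=
    hinj v hx hy h
  have hp : c p = i₀ := (hmem p).2 (by simp)
  have hq : c q = i₀ := (hmem q).2 (by simp)
  have hr : c r = i₀ := (hmem r).2 (by simp)
  have hjoin_aux {u v u' n t : V} (huv : u ≠ v) (huu' : u ≠ u') (hvu' : v ≠ u')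
      (hu : c u = i₀) (hv : c v = i₀) (hu' : c u' = i₀) (hn : G.Adj u n)
      (htc : c t ≠ i₀) (ht : ∀ s, c s = i₀ → ¬G.Adj t s) : G.Adj n t := by
    by_contra hnt
    have hindep {a b : V} (ha : c a = i₀) (hb : c b = i₀) : ¬G.Adj a b :=
      fun h => hproper a b h (ha.trans hb.symm)
    have hnc : c n ≠ i₀ := fun h => hindep hu h hn
    have hnv : ¬G.Adj v n := fun h => huv (hcommon hn.symm h.symm (hu.trans hv.symm))
    have hnu' : ¬G.Adj u' n := fun h => huu' (hcommon hn.symm h.symm (hu.trans hu'.symm))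
    have hne {s z : V} (hs : c s = i₀) (hz : c z ≠ i₀) : s ≠ z := by
      rintro rfl
      exact hz hs
    refine hfree v u' t u n hvu' (hne hv htc) huv.symm (hne hv hnc) (hne hu' htc)
      huu'.symm (hne hu' hnc) (hne hu htc).symm ?_ hn.ne
      ⟨hn, hindep hv hu', fun h => ht v hv h.symm, fun h => ht u' hu' h.symm,
        hindep hv hu, hnv, hindep hu' hu, hnu', ht u hu, fun h => hnt h.symm⟩
    rintro rfl
    exact ht u hu hn.symm
  have hjoin {u n t : V} (hu : c u = i₀) (hn : G.Adj u n) (htc : c t ≠ i₀)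
      (ht : ∀ s, c s = i₀ → ¬G.Adj t s) : G.Adj n t := by
    rcases (hmem u).1 hu with rfl | rfl | rfl
    · exact hjoin_aux hpq hpr hqr hp hq hr hn htc ht
    · exact hjoin_aux hpq.symm hqr hpr hq hp hr hn htc ht
    · exact hjoin_aux hpr.symm hqr.symm hpq hr hp hq hn htc ht
  have : Nontrivial V := ⟨p, q, hpq⟩
  obtain ⟨n, hn⟩ := hconn.preconnected.exists_adj_of_nontrivial p
  rintro j hj ⟨x, hx : c x = j⟩
  refine Set.ncard_eq_one.mpr ⟨x, Set.eq_singleton_iff_unique_mem.mpr ⟨hx, fun y hy => ?_⟩⟩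
  have hy : c y = j := hy
  have hxy : c x = c y := hx.trans hy.symm
  by_cases hxU : ∃ s, c s = i₀ ∧ G.Adj x s
  · obtain ⟨s, hs, hxs⟩ := hxU
    by_cases hyU : ∃ s, c s = i₀ ∧ G.Adj y s
    · obtain ⟨s', hs', hys'⟩ := hyU
      exact (hcommon (hjoin hs hxs.symm hwc hwU).symm
        (hjoin hs' hys'.symm hwc hwU).symm hxy).symm
    · push Not at hyU
      exact (hproper x y (hjoin hs hxs.symm (hy ▸ hj) hyU) hxy).elim
  · push Not at hxU
    by_cases hyU : ∃ s, c s = i₀ ∧ G.Adj y s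
    · obtain ⟨s', hs', hys'⟩ := hyU
      exact (hproper y x (hjoin hs' hys'.symm (hx ▸ hj) hxU) hxy.symm).elim
    · push Not at hyU
      exact (hcommon (hjoin hp hn (hx ▸ hj) hxU) (hjoin hp hn (hy ▸ hj) hyU) hxy).symm
end

section
/- Let G be a finite connected (3P_1+P_2)-free graph that contains an induced 4P_1, and let c be an injective colouring of G having a colour class U of size exactly 3 such that every vertex of G outside U is adjacent to at least one vertex of U. Then U is the only colour class of c of size 3, i.e., every other colour class has size at most 2. -/
/-- In a `(3P₁+P₂)`-free graph, no edge `ab` misses an independent triple `x, y, z`. This is the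
freeness condition without the redundant distinctness between the triple and the edge. -/
theorem not_adj_of_independent_triple {V : Type*} {G : SimpleGraph V}
    (hfree : ∀ x y z a b : V,
      x ≠ y → x ≠ z → x ≠ a → x ≠ b → y ≠ z → y ≠ a → y ≠ b → z ≠ a → z ≠ b → a ≠ b →
      ¬(G.Adj a b ∧ ¬G.Adj x y ∧ ¬G.Adj x z ∧ ¬G.Adj y z ∧
        ¬G.Adj x a ∧ ¬G.Adj x b ∧ ¬G.Adj y a ∧ ¬G.Adj y b ∧ ¬G.Adj z a ∧ ¬G.Adj z b))
    {x y z a b : V} (hxy : x ≠ y) (hxz : x ≠ z) (hyz : y ≠ z)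
    (nxy : ¬G.Adj x y) (nxz : ¬G.Adj x z) (nyz : ¬G.Adj y z)
    (nxa : ¬G.Adj x a) (nxb : ¬G.Adj x b) (nya : ¬G.Adj y a) (nyb : ¬G.Adj y b)
    (nza : ¬G.Adj z a) (nzb : ¬G.Adj z b) : ¬G.Adj a b := by
  intro hab
  have key : ∀ t : V, ¬G.Adj t a → ¬G.Adj t b → t ≠ a ∧ t ≠ b := by
    rintro t ha hb
    exact ⟨fun h => hb (h ▸ hab), fun h => ha (h ▸ hab.symm)⟩
  obtain ⟨hxa, hxb⟩ := key x nxa nxb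
  obtain ⟨hya, hyb⟩ := key y nya nyb
  obtain ⟨hza, hzb⟩ := key z nza nzb
  exact hfree x y z a b hxy hxz hxa hxb hyz hya hyb hza hzb hab.ne
    ⟨hab, nxy, nxz, nyz, nxa, nxb, nya, nyb, nza, nzb⟩

/-- An induced `3P₂` whose edges `uᵢwᵢ` join two colour classes of an injective colouring. -/
structure InducedMatching {V : Type*} (G : SimpleGraph V) (u₁ u₂ u₃ w₁ w₂ w₃ : V) : Prop where
  adj₁ : G.Adj u₁ w₁
  adj₂ : G.Adj u₂ w₂
  adj₃ : G.Adj u₃ w₃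
  ne_u : u₁ ≠ u₂ ∧ u₁ ≠ u₃ ∧ u₂ ≠ u₃
  ne_w : w₁ ≠ w₂ ∧ w₁ ≠ w₃ ∧ w₂ ≠ w₃
  indep_u : ¬G.Adj u₁ u₂ ∧ ¬G.Adj u₁ u₃ ∧ ¬G.Adj u₂ u₃
  indep_w : ¬G.Adj w₁ w₂ ∧ ¬G.Adj w₁ w₃ ∧ ¬G.Adj w₂ w₃
  unique_u : ∀ v, ¬(G.Adj v u₁ ∧ G.Adj v u₂) ∧ ¬(G.Adj v u₁ ∧ G.Adj v u₃) ∧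
    ¬(G.Adj v u₂ ∧ G.Adj v u₃)
  unique_w : ∀ v, ¬(G.Adj v w₁ ∧ G.Adj v w₂) ∧ ¬(G.Adj v w₁ ∧ G.Adj v w₃) ∧
    ¬(G.Adj v w₂ ∧ G.Adj v w₃)

namespace InducedMatching

variable {V : Type*} {G : SimpleGraph V} {u₁ u₂ u₃ w₁ w₂ w₃ : V}

theorem rotate (h : InducedMatching G u₁ u₂ u₃ w₁ w₂ w₃) :
    InducedMatching G u₂ u₃ u₁ w₂ w₃ w₁ := by
  obtain ⟨a₁, a₂, a₃, nu, nw, iu, iw, qu, qw⟩ := h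
  constructor <;> grind [SimpleGraph.adj_comm]

theorem swap (h : InducedMatching G u₁ u₂ u₃ w₁ w₂ w₃) :
    InducedMatching G u₁ u₃ u₂ w₁ w₃ w₂ := by
  obtain ⟨a₁, a₂, a₃, nu, nw, iu, iw, qu, qw⟩ := h
  constructor <;> grind [SimpleGraph.adj_comm]

theorem not_adj_cross (h : InducedMatching G u₁ u₂ u₃ w₁ w₂ w₃) :
    ¬G.Adj w₁ u₂ ∧ ¬G.Adj w₁ u₃ :=
  ⟨fun h' => (h.unique_u w₁).1 ⟨h.adj₁.symm, h'⟩, fun h' => (h.unique_u w₁).2.1 ⟨h.adj₁.symm, h'⟩⟩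

theorem adj_or_adj
    (hfree : ∀ x y z a b : V,
      x ≠ y → x ≠ z → x ≠ a → x ≠ b → y ≠ z → y ≠ a → y ≠ b → z ≠ a → z ≠ b → a ≠ b →
      ¬(G.Adj a b ∧ ¬G.Adj x y ∧ ¬G.Adj x z ∧ ¬G.Adj y z ∧
        ¬G.Adj x a ∧ ¬G.Adj x b ∧ ¬G.Adj y a ∧ ¬G.Adj y b ∧ ¬G.Adj z a ∧ ¬G.Adj z b))
    (h : InducedMatching G u₁ u₂ u₃ w₁ w₂ w₃) {v : V} (hv : G.Adj v u₁) (hne : v ≠ w₁) :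
    G.Adj v w₁ ∨ G.Adj v w₂ := by
  by_contra! hn
  have hu := h.unique_u v
  have c₁ := h.not_adj_cross
  have c₃ := h.rotate.rotate.not_adj_cross
  have iu := h.indep_u
  have iw := h.indep_w
  refine not_adj_of_independent_triple hfree (x := v) (y := w₁) (z := u₃) hne ?_ ?_ ?_ ?_ ?_
    ?_ ?_ ?_ ?_ ?_ ?_ h.adj₂
  · rintro rfl
    exact iu.2.1 hv.symm
  · rintro rfl
    exact iu.2.1 h.adj₁
  · exact hn.1
  · tauto
  · exact c₁.2
  · tauto
  · exact hn.2
  · exact c₁.1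
  · exact iw.1
  · exact fun e => iu.2.2 e.symm
  · exact fun e => h.rotate.not_adj_cross.1 e.symm

theorem adj_w_of_adj_u
    (hfree : ∀ x y z a b : V,
      x ≠ y → x ≠ z → x ≠ a → x ≠ b → y ≠ z → y ≠ a → y ≠ b → z ≠ a → z ≠ b → a ≠ b →
      ¬(G.Adj a b ∧ ¬G.Adj x y ∧ ¬G.Adj x z ∧ ¬G.Adj y z ∧
        ¬G.Adj x a ∧ ¬G.Adj x b ∧ ¬G.Adj y a ∧ ¬G.Adj y b ∧ ¬G.Adj z a ∧ ¬G.Adj z b))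
    (h : InducedMatching G u₁ u₂ u₃ w₁ w₂ w₃) {v : V} (hv : G.Adj v u₁) (hne : v ≠ w₁) :
    G.Adj v w₁ := by
  have h₂ := h.adj_or_adj hfree hv hne
  have h₃ := h.swap.adj_or_adj hfree hv hne
  have := h.unique_w v
  tauto

theorem adj_of_mem_closedNeighbors
    (hfree : ∀ x y z a b : V,
      x ≠ y → x ≠ z → x ≠ a → x ≠ b → y ≠ z → y ≠ a → y ≠ b → z ≠ a → z ≠ b → a ≠ b →
      ¬(G.Adj a b ∧ ¬G.Adj x y ∧ ¬G.Adj x z ∧ ¬G.Adj y z ∧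
        ¬G.Adj x a ∧ ¬G.Adj x b ∧ ¬G.Adj y a ∧ ¬G.Adj y b ∧ ¬G.Adj z a ∧ ¬G.Adj z b))
    (h : InducedMatching G u₁ u₂ u₃ w₁ w₂ w₃) {x y : V} (hxy : x ≠ y)
    (hx : x = u₁ ∨ G.Adj x u₁) (hy : y = u₁ ∨ G.Adj y u₁) : G.Adj x y := by
  rcases hx with rfl | hx
  · exact (hy.resolve_left hxy.symm).symm
  rcases hy with rfl | hy
  · exact hx
  by_cases hxw : x = w₁
  · subst hxw
    exact (h.adj_w_of_adj_u hfree hy hxy.symm).symm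
  by_cases hyw : y = w₁
  · subst hyw
    exact h.adj_w_of_adj_u hfree hx hxy
  have hxw₁ := h.adj_w_of_adj_u hfree hx hxw
  have hyw₁ := h.adj_w_of_adj_u hfree hy hyw
  have ux := h.unique_u x
  have uy := h.unique_u y
  have wx := h.unique_w x
  have wy := h.unique_w y
  have iu := h.indep_u
  by_contra hn
  refine not_adj_of_independent_triple hfree (x := x) (y := y) (z := u₃) hxy ?_ ?_ hn ?_ ?_
    ?_ ?_ ?_ ?_ ?_ ?_ h.adj₂
  · rintro rfl
    exact iu.2.1 hx.symm
  · rintro rfl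
    exact iu.2.1 hy.symm
  · exact fun e => ux.2.1 ⟨hx, e⟩
  · exact fun e => uy.2.1 ⟨hy, e⟩
  · exact fun e => ux.1 ⟨hx, e⟩
  · exact fun e => wx.1 ⟨hxw₁, e⟩
  · exact fun e => uy.1 ⟨hy, e⟩
  · exact fun e => wy.1 ⟨hyw₁, e⟩
  · exact fun e => iu.2.2 e.symm
  · exact fun e => h.rotate.not_adj_cross.1 e.symm

end InducedMatching


/-- Let `G` be a finite connected `(3P₁+P₂)`-free graph containing
an induced `4P₁`, and let `c` be an injective colouring of `G` with a colour
class `U` (of colour `i₀`) of size exactly 3, such that every vertex outside `U`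
has a neighbour in `U`. Then every other colour class has size at most 2. -/
theorem stmt_16 {V : Type*} [Fintype V] (G : SimpleGraph V)
    (hconn : G.Connected)
    (hfree : ∀ x y z a b : V,
      x ≠ y → x ≠ z → x ≠ a → x ≠ b → y ≠ z → y ≠ a → y ≠ b → z ≠ a → z ≠ b → a ≠ b →
      ¬(G.Adj a b ∧ ¬G.Adj x y ∧ ¬G.Adj x z ∧ ¬G.Adj y z ∧
        ¬G.Adj x a ∧ ¬G.Adj x b ∧ ¬G.Adj y a ∧ ¬G.Adj y b ∧ ¬G.Adj z a ∧ ¬G.Adj z b))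
    (h4P1 : ∃ a b d e : V, a ≠ b ∧ a ≠ d ∧ a ≠ e ∧ b ≠ d ∧ b ≠ e ∧ d ≠ e ∧
      ¬G.Adj a b ∧ ¬G.Adj a d ∧ ¬G.Adj a e ∧ ¬G.Adj b d ∧ ¬G.Adj b e ∧ ¬G.Adj d e)
    (c : V → ℕ)
    (hproper : ∀ u v, G.Adj u v → c u ≠ c v)
    (hinj : ∀ v, Set.InjOn c (G.neighborSet v))
    (i₀ : ℕ) (hU : ({v : V | c v = i₀}).ncard = 3)
    (hdom : ∀ w : V, c w ≠ i₀ → ∃ u : V, c u = i₀ ∧ G.Adj w u) :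
    ∀ j : ℕ, j ≠ i₀ → ({v : V | c v = j}).ncard ≤ 2 := by
  intro j hj
  by_contra! hcard
  obtain ⟨w₁, w₂, w₃, hw₁, hw₂, hw₃, h₁₂, h₁₃, h₂₃⟩ :=
    (Set.two_lt_ncard_iff (Set.toFinite _)).1 hcard
  simp only [Set.mem_ofPred_eq] at hw₁ hw₂ hw₃
  have huniq : ∀ v x y, x ≠ y → c x = c y → ¬(G.Adj v x ∧ G.Adj v y) :=
    fun v x y hne hxy h => hne (hinj v h.1 h.2 hxy)
  have hindep : ∀ x y, c x = c y → ¬G.Adj x y := fun x y h h' => hproper x y h' h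
  obtain ⟨u₁, hu₁, a₁⟩ := hdom w₁ (hw₁ ▸ hj)
  obtain ⟨u₂, hu₂, a₂⟩ := hdom w₂ (hw₂ ▸ hj)
  obtain ⟨u₃, hu₃, a₃⟩ := hdom w₃ (hw₃ ▸ hj)
  have k₁₂ : u₁ ≠ u₂ := by
    rintro rfl
    exact huniq u₁ w₁ w₂ h₁₂ (hw₁.trans hw₂.symm) ⟨a₁.symm, a₂.symm⟩
  have k₁₃ : u₁ ≠ u₃ := by
    rintro rfl
    exact huniq u₁ w₁ w₃ h₁₃ (hw₁.trans hw₃.symm) ⟨a₁.symm, a₃.symm⟩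
  have k₂₃ : u₂ ≠ u₃ := by
    rintro rfl
    exact huniq u₂ w₂ w₃ h₂₃ (hw₂.trans hw₃.symm) ⟨a₂.symm, a₃.symm⟩
  have hM : InducedMatching G u₁ u₂ u₃ w₁ w₂ w₃ := by
    constructor <;> grind [SimpleGraph.adj_comm]
  have hUeq : {u₁, u₂, u₃} = {v : V | c v = i₀} := by
    refine Set.eq_of_subset_of_ncard_le ?_ ?_ (Set.toFinite _)
    · rintro x (rfl | rfl | rfl) <;> assumption
    · rw [hU, Set.ncard_eq_three.2 ⟨u₁, u₂, u₃, k₁₂, k₁₃, k₂₃, rfl⟩]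
  have hmem : ∀ v, c v = i₀ → v = u₁ ∨ v = u₂ ∨ v = u₃ := by
    intro v hv
    have : v ∈ ({u₁, u₂, u₃} : Set V) := hUeq ▸ hv
    simpa using this
  have hcover : ∀ v, (v = u₁ ∨ G.Adj v u₁) ∨ (v = u₂ ∨ G.Adj v u₂) ∨ (v = u₃ ∨ G.Adj v u₃) := by
    intro v
    by_cases hv : c v = i₀
    · have := hmem v hv
      tauto
    · obtain ⟨u, hu, hvu⟩ := hdom v hv
      rcases hmem u hu with rfl | rfl | rfl <;> tauto
  have q₁ := fun x y hxy => hM.adj_of_mem_closedNeighbors hfree (x := x) (y := y) hxy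
  have q₂ := fun x y hxy => hM.rotate.adj_of_mem_closedNeighbors hfree (x := x) (y := y) hxy
  have q₃ := fun x y hxy => hM.rotate.rotate.adj_of_mem_closedNeighbors hfree (x := x) (y := y) hxy
  obtain ⟨a, b, d, e, hab, had, hae, hbd, hbe, hde, nab, nad, nae, nbd, nbe, nde⟩ := h4P1
  have ca := hcover a
  have cb := hcover b
  have cd := hcover d
  have ce := hcover e
  clear hcover hM hmem hUeq hU hdom hinj hproper hfree huniq hindep
  grind
end

section
/- Let G be a finite simple graph on n vertices. Define the auxiliary graph H on the vertex set of G in which two distinct vertices u and v are adjacent if and only if u and v are non-adjacent in G and have no common neighbour in G. Then the minimum number of distinct colours used by an injective colouring of G in which every colour class has size at most 2 (a 2-injective colouring) equals n − ν(H), where ν(H) denotes the maximum size of a matching in H. -/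
/-- A map whose fibres have at most two points has as many values as its domain has points, up to
the number of two-point fibres. -/
lemma card_image_add_card_pairs {V α : Type*} [Fintype V] [DecidableEq α] (c : V → α)
    (hc : ∀ i, (Finset.univ.filter (c · = i)).card ≤ 2) :
    (Finset.univ.image c).card +
      ((Finset.univ.image c).filter
        (fun i => (Finset.univ.filter (c · = i)).card = 2)).card = Fintype.card V := by
  rw [← Finset.card_univ, Finset.card_eq_sum_card_image c Finset.univ, Finset.card_filter,
    Finset.card_eq_sum_ones, ← Finset.sum_add_distrib]
  refine Finset.sum_congr rfl fun i hi => ?_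
  obtain ⟨v, -, rfl⟩ := Finset.mem_image.1 hi
  have h1 : 0 < (Finset.univ.filter (c · = c v)).card := Finset.card_pos.2 ⟨v, by simp⟩
  have h2 := hc (c v)
  split_ifs <;> omega

/-- If distinct points with equal values are adjacent in `H`, then the two-point fibres form a
matching of `H`. -/
lemma exists_matching_of_fibers {V α : Type*} [Fintype V] [DecidableEq V] [DecidableEq α]
    (H : SimpleGraph V) (c : V → α) (hc : ∀ u v, u ≠ v → c u = c v → H.Adj u v) :
    ∃ M : Finset (Sym2 V), (∀ e ∈ M, e ∈ H.edgeSet) ∧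
      (∀ e ∈ M, ∀ f ∈ M, e ≠ f → ∀ v : V, ¬(v ∈ e ∧ v ∈ f)) ∧
      M.card = ((Finset.univ.image c).filter
        (fun i => (Finset.univ.filter (c · = i)).card = 2)).card := by
  set D := (Finset.univ.image c).filter
    (fun i => (Finset.univ.filter (c · = i)).card = 2) with hD
  have key : ∀ i : D, ∃ e : Sym2 V, e ∈ H.edgeSet ∧ ∀ v, v ∈ e ↔ c v = i := by
    rintro ⟨i, hi⟩
    obtain ⟨x, y, hxy, h⟩ := Finset.card_eq_two.1 (Finset.mem_filter.1 hi).2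
    have hm : ∀ v, c v = i ↔ v = x ∨ v = y := fun v => by
      simpa using Finset.ext_iff.1 h v
    have hx := (hm x).2 (Or.inl rfl)
    have hy := (hm y).2 (Or.inr rfl)
    exact ⟨s(x, y), hc x y hxy (hx.trans hy.symm), fun v => by simp [hm]⟩
  choose e he hmem using key
  have meet : ∀ i j : D, ∀ v, v ∈ e i → v ∈ e j → i = j := fun i j v hi hj =>
    Subtype.ext (((hmem i v).1 hi).symm.trans ((hmem j v).1 hj))
  refine ⟨Finset.univ.image e, ?_, ?_, ?_⟩
  · intro a ha
    obtain ⟨i, -, rfl⟩ := Finset.mem_image.1 ha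
    exact he i
  · intro a ha b hb hab v hv
    obtain ⟨i, -, rfl⟩ := Finset.mem_image.1 ha
    obtain ⟨j, -, rfl⟩ := Finset.mem_image.1 hb
    exact hab (congrArg e (meet i j v hv.1 hv.2))
  · rw [Finset.card_image_of_injective, Finset.card_univ, Fintype.card_coe]
    intro i j hij
    exact meet i j _ (e i).out_fst_mem (hij ▸ (e i).out_fst_mem)

/-- A matching of `H` gives a colouring with classes of size at most two, in which distinct vertices
of the same colour are adjacent in `H` and every edge of the matching is a colour class. -/
lemma exists_colouring_of_matching {V : Type*} [Fintype V] [DecidableEq V]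
    (H : SimpleGraph V) (M : Finset (Sym2 V)) (hM : ∀ e ∈ M, e ∈ H.edgeSet)
    (hdisj : ∀ e ∈ M, ∀ f ∈ M, e ≠ f → ∀ v : V, ¬(v ∈ e ∧ v ∈ f)) :
    ∃ c : V → ℕ, (∀ u v, u ≠ v → c u = c v → H.Adj u v) ∧
      (∀ i, (Finset.univ.filter (c · = i)).card ≤ 2) ∧
      M.card ≤ ((Finset.univ.image c).filter
        (fun i => (Finset.univ.filter (c · = i)).card = 2)).card := by
  have key : ∀ v : V, ∃ e : Sym2 V, v ∈ e ∧ (e ∈ M ∨ e = s(v, v) ∧ ∀ f ∈ M, v ∉ f) := by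
    intro v
    by_cases h : ∃ e ∈ M, v ∈ e
    · obtain ⟨e, he, hv⟩ := h
      exact ⟨e, hv, Or.inl he⟩
    · push Not at h
      exact ⟨s(v, v), by simp, Or.inr ⟨rfl, h⟩⟩
  choose f hmem hf using key
  have hfM : ∀ e ∈ M, ∀ v ∈ e, f v = e := by
    intro e he v hv
    rcases hf v with h | h
    · by_contra hne
      exact hdisj _ h _ he hne v ⟨hmem v, hv⟩
    · exact absurd hv (h.2 e he)
  let g : Sym2 V → ℕ := fun e => Fintype.equivFin (Sym2 V) e
  have hg : Function.Injective g :=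
    Fin.val_injective.comp (Fintype.equivFin (Sym2 V)).injective
  have hfib : ∀ i, (Finset.univ.filter ((g ∘ f) · = i)).card ≤ 2 := by
    intro i
    rcases (Finset.univ.filter ((g ∘ f) · = i)).eq_empty_or_nonempty with h | ⟨v, hv⟩
    · rw [h]
      simp
    · refine (Finset.card_le_card (t := (f v).toFinset) fun u hu => ?_).trans ?_
      · have : f u = f v := hg (by simp_all)
        rw [Sym2.mem_toFinset, ← this]
        exact hmem u
      · rw [Sym2.card_toFinset]
        split_ifs <;> omega
  refine ⟨g ∘ f, fun u v huv h => ?_, hfib, ?_⟩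
  · have huv' : f u = f v := hg h
    have hu := hmem u
    have hv := hmem v
    rw [← huv'] at hv
    have he : f u = s(u, v) := (Sym2.mem_and_mem_iff huv).1 ⟨hu, hv⟩
    rcases hf u with h | h
    · rw [he] at h
      exact hM _ h
    · rw [h.1] at hv
      simp [huv.symm] at hv
  · rw [← Finset.card_image_of_injective M hg]
    refine Finset.card_le_card fun i hi => ?_
    obtain ⟨e, he, rfl⟩ := Finset.mem_image.1 hi
    induction e using Sym2.ind with | _ x y
    have hx := hfM _ he x (by simp)
    have hy := hfM _ he y (by simp)
    have hxy : x ≠ y := H.ne_of_adj (hM _ he)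
    refine Finset.mem_filter.2 ⟨Finset.mem_image.2 ⟨x, by simp, by simp [hx]⟩,
      le_antisymm (hfib _) ?_⟩
    rw [← Finset.card_pair hxy]
    refine Finset.card_le_card fun u hu => ?_
    rcases Finset.mem_insert.1 hu with rfl | hu
    · simp [hx]
    · simp [Finset.mem_singleton.1 hu, hy]


/-- Let `H` be the graph on `V(G)` in which two distinct vertices
are adjacent iff they are non-adjacent in `G` and have no common neighbour in
`G`. Then the minimum number of colours used by a 2-injective colouring of `G`
equals `n − ν(H)`, where `ν(H)` is the maximum size of a matching in `H`. -/
theorem stmt_17 {V : Type*} [Fintype V] [DecidableEq V] (G : SimpleGraph V)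
    (H : SimpleGraph V)
    (hH : ∀ u v : V, H.Adj u v ↔ u ≠ v ∧ ¬G.Adj u v ∧ ¬∃ w, G.Adj u w ∧ G.Adj v w)
    (ν : ℕ)
    (hν : IsGreatest {m : ℕ | ∃ M : Finset (Sym2 V), (∀ e ∈ M, e ∈ H.edgeSet) ∧
      (∀ e ∈ M, ∀ f ∈ M, e ≠ f → ∀ v : V, ¬(v ∈ e ∧ v ∈ f)) ∧ M.card = m} ν) :
    IsLeast {k : ℕ | ∃ c : V → ℕ,
      (∀ u v, G.Adj u v → c u ≠ c v) ∧
      (∀ v, Set.InjOn c (G.neighborSet v)) ∧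
      (∀ i : ℕ, ({v : V | c v = i}).ncard ≤ 2) ∧
      (Finset.univ.image c).card = k} (Fintype.card V - ν) := by
  have hfib : ∀ (c : V → ℕ) (i : ℕ),
      ({v : V | c v = i}).ncard = (Finset.univ.filter (c · = i)).card := fun c i => by
    rw [← Set.ncard_coe_finset]
    simp
  obtain ⟨⟨M, hM, hdisj, hcard⟩, hmax⟩ := hν
  constructor
  · obtain ⟨c, hc, hc2, hle⟩ := exists_colouring_of_matching H M hM hdisj
    refine ⟨c, fun u v huv h => ((hH u v).1 (hc u v huv.ne h)).2.1 huv, ?_,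
      fun i => (hfib c i).trans_le (hc2 i), ?_⟩
    · intro w u hu v hv h
      by_contra hne
      exact ((hH u v).1 (hc u v hne h)).2.2 ⟨w, hu.symm, hv.symm⟩
    · have h1 := hmax (exists_matching_of_fibers H c hc)
      have h2 := card_image_add_card_pairs c hc2
      omega
  · rintro k ⟨c, hproper, hinj, hc2, rfl⟩
    have hc : ∀ u v, u ≠ v → c u = c v → H.Adj u v := fun u v hne h =>
      (hH u v).2 ⟨hne, fun huv => hproper u v huv h,
        fun ⟨w, hu, hv⟩ => hne (hinj w (hu.symm) (hv.symm) h)⟩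
    have h1 := hmax (exists_matching_of_fibers H c hc)
    have h2 := card_image_add_card_pairs c fun i => (hfib c i).symm.trans_le (hc2 i)
    omega
end

section
/- Let k ≥ 4 be an integer and let G be a finite simple graph. Let G' be the graph obtained from G as follows: for every edge uv of G, delete the edge uv, add new vertices u'_v adjacent to u and v'_u adjacent to v, and add an independent set I_uv of k−2 new vertices each adjacent to exactly u'_v and v'_u. Then G' is bipartite, and G' has an injective k-colouring if and only if G has an injective k-colouring. -/
theorem exists_injective_avoiding_pair {k : ℕ} (a b : Fin k) :
    ∃ f : Fin (k - 2) → Fin k, Function.Injective f ∧ ∀ i, f i ≠ a ∧ f i ≠ b := by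
  have hcard : k - 2 ≤ (({a, b} : Finset (Fin k))ᶜ).card := by
    have h := Finset.card_le_two (a := a) (b := b)
    rw [Finset.card_compl, Fintype.card_fin]
    omega
  obtain ⟨t, hts, ht⟩ := Finset.exists_subset_card_eq hcard
  refine ⟨fun i => t.orderEmbOfFin ht i, (t.orderEmbOfFin ht).injective, fun i => ?_⟩
  have h := hts (t.orderEmbOfFin_mem ht i)
  simpa [not_or] using h

theorem eq_of_avoided_by_injective {k : ℕ} (hk : 2 ≤ k) {f : Fin (k - 2) → Fin k}
    (hf : Function.Injective f) {a b d : Fin k} (ha : ∀ i, f i ≠ a) (hb : ∀ i, f i ≠ b)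
    (hd : ∀ i, f i ≠ d) (hba : b ≠ a) (hda : d ≠ a) : b = d := by
  by_contra hbd
  have hdisj : Disjoint (Finset.univ.image f) {a, b, d} := by
    rw [Finset.disjoint_left]
    intro x hx hx'
    obtain ⟨i, -, rfl⟩ := Finset.mem_image.1 hx
    simp [ha i, hb i, hd i] at hx'
  have h3 : ({a, b, d} : Finset (Fin k)).card = 3 :=
    Finset.card_eq_three.2 ⟨a, b, d, hba.symm, hda.symm, hbd, rfl⟩
  have h := Finset.card_le_univ (Finset.univ.image f ∪ {a, b, d})
  rw [Finset.card_union_of_disjoint hdisj, Finset.card_image_of_injective _ hf, h3] at h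
  simp only [Finset.card_univ, Fintype.card_fin] at h
  omega


/-- For `k ≥ 4`, let `G'` be obtained from `G` by replacing every
edge `uv` by the gadget consisting of new vertices `u'_v` (adjacent to `u`),
`v'_u` (adjacent to `v`) and an independent set `I_uv` of `k−2` new vertices,
each adjacent exactly to `u'_v` and `v'_u`. Then `G'` is bipartite, and `G'` has
an injective `k`-colouring iff `G` has an injective `k`-colouring. -/
theorem stmt_18 {V : Type*} [Fintype V] (G : SimpleGraph V) (k : ℕ) (hk : 4 ≤ k)
    (G' : SimpleGraph (V ⊕ ({p : V × V // G.Adj p.1 p.2} ⊕ (↥G.edgeSet × Fin (k - 2)))))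
    (hVV : ∀ x y : V, ¬G'.Adj (Sum.inl x) (Sum.inl y))
    (hVP : ∀ (x : V) (p : {p : V × V // G.Adj p.1 p.2}),
      G'.Adj (Sum.inl x) (Sum.inr (Sum.inl p)) ↔ x = p.1.1)
    (hPP : ∀ p q : {p : V × V // G.Adj p.1 p.2},
      ¬G'.Adj (Sum.inr (Sum.inl p)) (Sum.inr (Sum.inl q)))
    (hPI : ∀ (p : {p : V × V // G.Adj p.1 p.2}) (w : ↥G.edgeSet × Fin (k - 2)),
      G'.Adj (Sum.inr (Sum.inl p)) (Sum.inr (Sum.inr w)) ↔ (w.1 : Sym2 V) = s(p.1.1, p.1.2))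
    (hVI : ∀ (x : V) (w : ↥G.edgeSet × Fin (k - 2)), ¬G'.Adj (Sum.inl x) (Sum.inr (Sum.inr w)))
    (hII : ∀ w w' : ↥G.edgeSet × Fin (k - 2),
      ¬G'.Adj (Sum.inr (Sum.inr w)) (Sum.inr (Sum.inr w'))) :
    (∃ S : Set (V ⊕ ({p : V × V // G.Adj p.1 p.2} ⊕ (↥G.edgeSet × Fin (k - 2)))),
      ∀ a b, G'.Adj a b → ((a ∈ S ∧ b ∉ S) ∨ (a ∉ S ∧ b ∈ S)))
    ∧ ((∃ c' : V ⊕ ({p : V × V // G.Adj p.1 p.2} ⊕ (↥G.edgeSet × Fin (k - 2))) → Fin k,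
        (∀ a b, G'.Adj a b → c' a ≠ c' b) ∧ ∀ a, Set.InjOn c' (G'.neighborSet a))
      ↔ (∃ c : V → Fin k,
        (∀ u v, G.Adj u v → c u ≠ c v) ∧ ∀ v, Set.InjOn c (G.neighborSet v))) := by
  have hPV (x : V) (p : {p : V × V // G.Adj p.1 p.2}) :
      G'.Adj (Sum.inr (Sum.inl p)) (Sum.inl x) ↔ x = p.1.1 := by
    rw [G'.adj_comm, hVP]
  have hIP (p : {p : V × V // G.Adj p.1 p.2}) (w : ↥G.edgeSet × Fin (k - 2)) :
      G'.Adj (Sum.inr (Sum.inr w)) (Sum.inr (Sum.inl p)) ↔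
        (w.1 : Sym2 V) = s(p.1.1, p.1.2) := by
    rw [G'.adj_comm, hPI]
  have hIV (x : V) (w : ↥G.edgeSet × Fin (k - 2)) :
      ¬G'.Adj (Sum.inr (Sum.inr w)) (Sum.inl x) := by
    rw [G'.adj_comm]
    exact hVI x w
  refine ⟨⟨{a | ∃ p, a = Sum.inr (Sum.inl p)}, ?_⟩, ?_, ?_⟩
  · rintro (x | p | w) (y | q | w') h
    · exact absurd h (hVV _ _)
    · exact Or.inr ⟨by simp, q, rfl⟩
    · exact absurd h (hVI _ _)
    · exact Or.inl ⟨⟨p, rfl⟩, by simp⟩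
    · exact absurd h (hPP _ _)
    · exact Or.inl ⟨⟨p, rfl⟩, by simp⟩
    · exact absurd h (hIV _ _)
    · exact Or.inr ⟨by simp, q, rfl⟩
    · exact absurd h (hII _ _)
  · rintro ⟨c', hproper, hinj⟩
    have key (u v : V) (huv : G.Adj u v) :
        c' (Sum.inl u) = c' (Sum.inr (Sum.inl ⟨(v, u), huv.symm⟩)) := by
      have hp (i : Fin (k - 2)) : G'.Adj (Sum.inr (Sum.inl ⟨(u, v), huv⟩))
          (Sum.inr (Sum.inr (⟨s(u, v), huv⟩, i))) := (hPI _ _).2 rfl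
      have hq (i : Fin (k - 2)) : G'.Adj (Sum.inr (Sum.inl ⟨(v, u), huv.symm⟩))
          (Sum.inr (Sum.inr (⟨s(u, v), huv⟩, i))) := (hPI _ _).2 Sym2.eq_swap
      have hu : G'.Adj (Sum.inr (Sum.inl ⟨(u, v), huv⟩)) (Sum.inl u) := (hPV _ _).2 rfl
      refine eq_of_avoided_by_injective (by omega)
        (f := fun i => c' (Sum.inr (Sum.inr (⟨s(u, v), huv⟩, i))))
        (a := c' (Sum.inr (Sum.inl ⟨(u, v), huv⟩))) ?_ (fun i => (hproper _ _ (hp i)).symm) ?_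
        (fun i => (hproper _ _ (hq i)).symm) (hproper _ _ hu).symm ?_
      · intro i j hij
        simpa using hinj _ (hp i) (hp j) hij
      · intro i hi
        simpa using hinj _ (hp i) hu hi
      · intro h
        have h' := hinj _ (hq ⟨0, by omega⟩).symm (hp ⟨0, by omega⟩).symm h
        simp only [Sum.inr.injEq, Sum.inl.injEq, Subtype.mk.injEq, Prod.mk.injEq] at h'
        exact huv.ne h'.2
    refine ⟨fun v => c' (Sum.inl v), fun u v huv => ?_, fun v x hx y hy hxy => ?_⟩
    · change c' _ ≠ c' _
      rw [key v u huv.symm]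
      exact hproper _ _ ((hVP _ _).2 rfl)
    · rw [SimpleGraph.mem_neighborSet] at hx hy
      have hxy' : c' (Sum.inl x) = c' (Sum.inl y) := hxy
      rw [key x v hx.symm, key y v hy.symm] at hxy'
      have h := hinj (Sum.inl v) ((hVP v ⟨(v, x), hx⟩).2 rfl) ((hVP v ⟨(v, y), hy⟩).2 rfl) hxy'
      simpa using h
  · rintro ⟨c, hproper, hinj⟩
    have hex (e : G.edgeSet) : ∃ f : Fin (k - 2) → Fin k, Function.Injective f ∧
        ∀ x ∈ (e : Sym2 V), ∀ i, f i ≠ c x := by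
      obtain ⟨e, he⟩ := e
      induction e using Sym2.ind with
      | _ u v =>
        obtain ⟨f, hf, hfuv⟩ := exists_injective_avoiding_pair (c u) (c v)
        refine ⟨f, hf, fun x hx i => ?_⟩
        rcases Sym2.mem_iff.1 hx with rfl | rfl
        · exact (hfuv i).1
        · exact (hfuv i).2
    choose f hf hfc using hex
    have hl (p : {p : V × V // G.Adj p.1 p.2}) (w : ↥G.edgeSet × Fin (k - 2))
        (h : (w.1 : Sym2 V) = s(p.1.1, p.1.2)) : f w.1 w.2 ≠ c p.1.1 :=
      hfc _ _ (h ▸ Sym2.mem_mk_left _ _) _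
    have hr (p : {p : V × V // G.Adj p.1 p.2}) (w : ↥G.edgeSet × Fin (k - 2))
        (h : (w.1 : Sym2 V) = s(p.1.1, p.1.2)) : f w.1 w.2 ≠ c p.1.2 :=
      hfc _ _ (h ▸ Sym2.mem_mk_right _ _) _
    refine ⟨Sum.elim c (Sum.elim (fun p => c p.1.2) (fun w => f w.1 w.2)), ?_, ?_⟩
    · rintro (x | p | w) (y | q | w') h
      · exact absurd h (hVV _ _)
      · obtain rfl := (hVP _ _).1 h
        exact hproper _ _ q.2
      · exact absurd h (hVI _ _)
      · obtain rfl := (hPV _ _).1 h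
        exact (hproper _ _ p.2).symm
      · exact absurd h (hPP _ _)
      · exact (hr _ _ ((hPI _ _).1 h)).symm
      · exact absurd h (hIV _ _)
      · exact hr _ _ ((hIP _ _).1 h)
      · exact absurd h (hII _ _)
    · rintro (x | p | w) (y | q | w') hy (z | r | w'') hz h <;>
        rw [SimpleGraph.mem_neighborSet] at hy hz <;>
        simp only [hVV, hVP, hPP, hPI, hVI, hII, hPV, hIP, hIV] at hy hz <;>
        simp only [Sum.elim_inl, Sum.elim_inr] at h
      · obtain ⟨⟨q₁, q₂⟩, hq⟩ := q
        obtain ⟨⟨r₁, r₂⟩, hr'⟩ := r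
        dsimp only at hy hz h hq hr'
        subst hy hz
        obtain rfl := hinj _ hq hr' h
        rfl
      · rw [hy, hz]
      · subst hy
        exact absurd h.symm (hl _ _ hz)
      · subst hz
        exact absurd h (hl _ _ hy)
      · obtain ⟨e, i⟩ := w'
        obtain ⟨e', j⟩ := w''
        obtain rfl : e = e' := Subtype.ext (hy.trans hz.symm)
        obtain rfl := hf _ h
        rfl
      · rcases Sym2.eq_iff.1 (hy.symm.trans hz) with ⟨h₁, h₂⟩ | ⟨-, h₂⟩
        · rw [Subtype.ext (Prod.ext h₁ h₂)]
        · rw [h₂] at h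
          exact absurd h (hproper _ _ r.2)
end

section
/- Let G be a finite simple graph whose vertex set is partitioned into three cliques A_1, A_2, A_3 such that every vertex of G has at least one neighbour outside its own clique. Let E* be the set of edges of G whose end-vertices lie in different cliques of {A_1, A_2, A_3}. Let G' be the graph obtained from G by deleting all edges of E* and adding, for each edge e = xy in E*, a new vertex v_e adjacent to x and y, where the set A_0 = {v_e : e ∈ E*} of new vertices forms a clique. Then for every integer k ≥ 1, G has a proper k-colouring if and only if G' has an injective (k + |E*|)-colouring. -/
/-- If `m` colours of `Fin (k + m)` are used injectively by `f`, a map avoiding the colours of `f`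
factors injectively through `Fin k`. -/
theorem exists_fin_relabel {V E : Type*} [Finite E] {k : ℕ} (f : E → Fin (k + Nat.card E))
    (hf : Function.Injective f) (g : V → Fin (k + Nat.card E)) (hg : ∀ v e, g v ≠ f e) :
    ∃ c : V → Fin k, ∀ u v, c u = c v → g u = g v := by
  classical
  have hcard : Fintype.card {x // x ∉ Set.range f} = k := by
    have h := Set.ncard_add_ncard_compl (Set.range f)
    rw [← Set.image_univ, Set.ncard_image_of_injective _ hf, Set.ncard_univ, Set.image_univ,
      Nat.card_fin, ← Nat.card_coe_set_eq, Nat.card_eq_fintype_card (α := ↥(Set.range f)ᶜ)] at h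
    have h' : Fintype.card ↥(Set.range f)ᶜ = Fintype.card {x // x ∉ Set.range f} :=
      Fintype.card_congr (Equiv.refl _)
    omega
  let φ := Fintype.equivFinOfCardEq hcard
  refine ⟨fun v => φ ⟨g v, fun ⟨e, he⟩ => hg v e he.symm⟩, fun u v h => ?_⟩
  exact congrArg Subtype.val (φ.injective h)

/-- Let `G` have its vertex set partitioned into three cliques
`A₁, A₂, A₃`, each vertex having a neighbour outside its own clique. Let `E*`
be the set of edges with end-vertices in different cliques, and let `G'` be
obtained from `G` by deleting all edges of `E*` and adding a clique
`A₀ = {v_e : e ∈ E*}` of new vertices, where `v_e` is adjacent to the two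
end-vertices of `e`. Then for every `k ≥ 1`, `G` has a proper `k`-colouring iff
`G'` has an injective `(k + |E*|)`-colouring. -/
theorem stmt_19 {V : Type*} [Fintype V] [DecidableEq V] (G : SimpleGraph V)
    (A1 A2 A3 : Set V)
    (hd12 : Disjoint A1 A2) (hd13 : Disjoint A1 A3) (hd23 : Disjoint A2 A3)
    (hcover : A1 ∪ A2 ∪ A3 = Set.univ)
    (hcl1 : ∀ u ∈ A1, ∀ v ∈ A1, u ≠ v → G.Adj u v)
    (hcl2 : ∀ u ∈ A2, ∀ v ∈ A2, u ≠ v → G.Adj u v)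
    (hcl3 : ∀ u ∈ A3, ∀ v ∈ A3, u ≠ v → G.Adj u v)
    (hout : ∀ A ∈ ({A1, A2, A3} : Set (Set V)), ∀ v ∈ A, ∃ w, G.Adj v w ∧ w ∉ A)
    (Estar : Set (Sym2 V))
    (hEstar : ∀ e : Sym2 V, e ∈ Estar ↔ e ∈ G.edgeSet ∧
      ¬((∀ v ∈ e, v ∈ A1) ∨ (∀ v ∈ e, v ∈ A2) ∨ (∀ v ∈ e, v ∈ A3)))
    (G' : SimpleGraph (V ⊕ ↥Estar))
    (hVV : ∀ x y : V, G'.Adj (Sum.inl x) (Sum.inl y) ↔ G.Adj x y ∧ s(x, y) ∉ Estar)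
    (hVE : ∀ (x : V) (e : ↥Estar), G'.Adj (Sum.inl x) (Sum.inr e) ↔ x ∈ (e : Sym2 V))
    (hEE : ∀ e f : ↥Estar, G'.Adj (Sum.inr e) (Sum.inr f) ↔ e ≠ f)
    (k : ℕ) (hk : 1 ≤ k) :
    (∃ c : V → Fin k, ∀ u v, G.Adj u v → c u ≠ c v)
    ↔ (∃ c' : V ⊕ ↥Estar → Fin (k + Estar.ncard),
        (∀ a b, G'.Adj a b → c' a ≠ c' b) ∧
        ∀ a, Set.InjOn c' (G'.neighborSet a)) := by
  have cross : ∀ x y, G.Adj x y → (s(x, y) ∈ Estar ↔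
      ¬((x ∈ A1 ∧ y ∈ A1) ∨ (x ∈ A2 ∧ y ∈ A2) ∨ (x ∈ A3 ∧ y ∈ A3))) := by
    intro x y h
    rw [hEstar]
    simp [h]
  have cover : ∀ v, v ∈ A1 ∨ v ∈ A2 ∨ v ∈ A3 := by
    intro v
    have h : v ∈ A1 ∪ A2 ∪ A3 := hcover ▸ Set.mem_univ v
    simpa [or_assoc] using h
  have same_clique : ∀ x a b, G.Adj x a → s(x, a) ∉ Estar → G.Adj x b → s(x, b) ∉ Estar →
      a ≠ b → G.Adj a b := by
    intro x a b hxa ha hxb hb hab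
    rw [cross x a hxa, not_not] at ha
    rw [cross x b hxb, not_not] at hb
    have h12 : x ∈ A1 → x ∉ A2 := fun h => Set.disjoint_left.mp hd12 h
    have h13 : x ∈ A1 → x ∉ A3 := fun h => Set.disjoint_left.mp hd13 h
    have h23 : x ∈ A2 → x ∉ A3 := fun h => Set.disjoint_left.mp hd23 h
    have h1 := hcl1 a
    have h2 := hcl2 a
    have h3 := hcl3 a
    grind
  have crossing_edge : ∀ v, ∃ e : ↥Estar, v ∈ (e : Sym2 V) := by
    intro v
    have key : ∃ w, G.Adj v w ∧ s(v, w) ∈ Estar := by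
      have h12 : v ∈ A1 → v ∉ A2 := fun h => Set.disjoint_left.mp hd12 h
      have h13 : v ∈ A1 → v ∉ A3 := fun h => Set.disjoint_left.mp hd13 h
      have h23 : v ∈ A2 → v ∉ A3 := fun h => Set.disjoint_left.mp hd23 h
      rcases cover v with hv | hv | hv
      · obtain ⟨w, hw, hwA⟩ := hout A1 (by simp) v hv
        exact ⟨w, hw, (cross v w hw).mpr (by tauto)⟩
      · obtain ⟨w, hw, hwA⟩ := hout A2 (by simp) v hv
        exact ⟨w, hw, (cross v w hw).mpr (by tauto)⟩
      · obtain ⟨w, hw, hwA⟩ := hout A3 (by simp) v hv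
        exact ⟨w, hw, (cross v w hw).mpr (by tauto)⟩
    obtain ⟨w, -, hw⟩ := key
    exact ⟨⟨s(v, w), hw⟩, Sym2.mem_mk_left v w⟩
  have hEV : ∀ (e : ↥Estar) (x : V), G'.Adj (Sum.inr e) (Sum.inl x) ↔ x ∈ (e : Sym2 V) :=
    fun e x => by rw [G'.adj_comm, hVE]
  rw [← Nat.card_coe_set_eq]
  constructor
  · rintro ⟨c, hc⟩
    let σ := Finite.equivFin ↥Estar
    have hne : ∀ (x : V) (e : ↥Estar),
        Fin.castAdd (Nat.card ↥Estar) (c x) ≠ Fin.natAdd k (σ e) := by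
      intro x e h
      have h' := congrArg Fin.val h
      simp only [Fin.val_castAdd, Fin.val_natAdd] at h'
      omega
    have hinj : ∀ e f : ↥Estar, Fin.natAdd k (σ e) = Fin.natAdd k (σ f) → e = f :=
      fun e f h => σ.injective (Fin.natAdd_injective _ k h)
    have hcast : ∀ x y : V, Fin.castAdd (Nat.card ↥Estar) (c x) = Fin.castAdd _ (c y) →
        c x = c y := fun x y h => Fin.castAdd_injective k _ h
    refine ⟨Sum.elim (fun v => Fin.castAdd _ (c v)) (fun e => Fin.natAdd k (σ e)), ?_, ?_⟩
    · rintro (x | e) (y | f) hadj heq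
      · exact hc x y ((hVV x y).mp hadj).1 (hcast x y heq)
      · exact hne x f heq
      · exact hne y e heq.symm
      · exact (hEE e f).mp hadj (hinj e f heq)
    · rintro z (x | e) hx (y | f) hy heq
      · by_contra hxy
        have hxy' : x ≠ y := fun h => hxy (congrArg Sum.inl h)
        refine hc x y ?_ (hcast x y heq)
        rw [SimpleGraph.mem_neighborSet] at hx hy
        rcases z with z | e
        · rw [hVV] at hx hy
          exact same_clique z x y hx.1 hx.2 hy.1 hy.2 hxy'
        · rw [hEV] at hx hy
          have he : (e : Sym2 V) = s(x, y) := (Sym2.mem_and_mem_iff hxy').mp ⟨hx, hy⟩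
          have := ((hEstar e).mp e.2).1
          rwa [he, SimpleGraph.mem_edgeSet] at this
      · exact (hne x f heq).elim
      · exact (hne y e heq.symm).elim
      · exact congrArg Sum.inr (hinj e f heq)
  · rintro ⟨c', hproper, hinj⟩
    have hne : ∀ (v : V) (e : ↥Estar), c' (Sum.inl v) ≠ c' (Sum.inr e) := by
      intro v e heq
      obtain ⟨f, hf⟩ := crossing_edge v
      by_cases hfe : f = e
      · exact hproper _ _ ((hVE v e).mpr (hfe ▸ hf)) heq
      · exact Sum.inl_ne_inr (hinj (Sum.inr f) ((hEV f v).mpr hf) ((hEE f e).mpr hfe) heq)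
    have hE : Function.Injective fun e : ↥Estar => c' (Sum.inr e) := by
      intro e f heq
      by_contra hef
      exact hproper _ _ ((hEE e f).mpr hef) heq
    obtain ⟨c, hc⟩ := exists_fin_relabel _ hE (fun v => c' (Sum.inl v)) hne
    refine ⟨c, fun u v huv h => ?_⟩
    have heq := hc u v h
    by_cases he : s(u, v) ∈ Estar
    · exact huv.ne (Sum.inl_injective (hinj (Sum.inr ⟨_, he⟩)
        ((hEV _ u).mpr (Sym2.mem_mk_left u v)) ((hEV _ v).mpr (Sym2.mem_mk_right u v)) heq))
    · exact hproper _ _ ((hVV u v).mpr ⟨huv, he⟩) heq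
end
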